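/- (Homogeneity via the Viro 2-cocycle) A configuration L={L₁,…,L₆} of 6 pairwise skew lines in RP³ is homogeneous — meaning all six 5-line subconfigurations L∖{Lᵢ} are pairwise coarse deformation equivalent — if and only if for every pair of indices i≠j the number of indices k∉{i,j} with lk(Lᵢ,Lⱼ,Lₖ)=+1 is even (equivalently, the mod-2 simplicial 2-chain of positive triples on the 6 vertices is a 2-cycle). -/

import Mathlib

open Submodule

abbrev V4 : Type := Fin 4 → ℝ

abbrev PLine : Type := Submodule ℝ V4

def IsLine (P : PLine) : Prop := Module.finrank ℝ P = 2

def Skew (P Q : PLine) : Prop := IsLine P ∧ IsLine Q ∧ P ⊓ Q = ⊥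

def PairwiseSkew {n : ℕ} (L : Fin n → PLine) : Prop :=
  ∀ i j : Fin n, i ≠ j → Skew (L i) (L j)

noncomputable def det2 (a b c d : V4) : ℝ := Matrix.det (Matrix.of ![a, b, c, d])

open Classical in
noncomputable def lk (P Q R : PLine) : ℝ :=
  if h : ∃ v : Fin 6 → V4,
      P = span ℝ {v 0, v 1} ∧ Q = span ℝ {v 2, v 3} ∧ R = span ℝ {v 4, v 5} then
    Real.sign (det2 (h.choose 0) (h.choose 1) (h.choose 2) (h.choose 3) *
      det2 (h.choose 0) (h.choose 1) (h.choose 4) (h.choose 5) *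
      det2 (h.choose 2) (h.choose 3) (h.choose 4) (h.choose 5))
  else 0

noncomputable def sgnOf {n : ℕ} (L : Fin n → PLine) : ℝ :=
  ∑ i : Fin n, ∑ j : Fin n, ∑ k : Fin n,
    if i < j ∧ j < k then lk (L i) (L j) (L k) else 0

def ContinuousLineFamily (L : ℝ → PLine) : Prop :=
  ∃ v w : ℝ → V4, ContinuousOn v (Set.Icc 0 1) ∧ ContinuousOn w (Set.Icc 0 1) ∧
    ∀ t ∈ Set.Icc (0:ℝ) 1, L t = span ℝ {v t, w t}

def Deformation {n : ℕ} (L L' : Fin n → PLine) : Prop :=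
  ∃ F : ℝ → Fin n → PLine,
    (∀ i, ContinuousLineFamily (fun t => F t i)) ∧
    (∀ t ∈ Set.Icc (0:ℝ) 1, PairwiseSkew (F t)) ∧
    F 0 = L ∧ F 1 = L'

def DeformEquiv {n : ℕ} (L L' : Fin n → PLine) : Prop :=
  ∃ π π' : Equiv.Perm (Fin n), Deformation (L ∘ π) (L' ∘ π')

def IsMirror {n : ℕ} (L L' : Fin n → PLine) : Prop :=
  ∃ A : V4 →ₗ[ℝ] V4, LinearMap.det A < 0 ∧ ∀ i, L' i = (L i).map A

def CoarseDeformEquiv {n : ℕ} (L L' : Fin n → PLine) : Prop :=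
  DeformEquiv L L' ∨ ∃ M : Fin n → PLine, IsMirror L' M ∧ DeformEquiv L M

noncomputable def joinConfig {n : ℕ} (σ : Equiv.Perm (Fin n)) : Fin n → PLine :=
  fun i => span ℝ {![1, (i.val : ℝ) + 1, 0, 0], ![0, 0, ((σ i).val : ℝ) + 1, 1]}

def IsSchlafliSix (L : Fin 6 → PLine) : Prop :=
  PairwiseSkew L ∧
  ∃ F : MvPolynomial (Fin 4) ℝ,
    F ≠ 0 ∧ F.IsHomogeneous 3 ∧
    (∀ i : Fin 6, ∀ x ∈ L i, MvPolynomial.eval x F = 0) ∧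
    (∀ z : Fin 4 → ℂ, z ≠ 0 →
      MvPolynomial.eval z (MvPolynomial.map (algebraMap ℝ ℂ) F) = 0 →
      ∃ j : Fin 4, MvPolynomial.eval z (MvPolynomial.map (algebraMap ℝ ℂ) (MvPolynomial.pderiv j F)) ≠ 0)

def Reducible {n : ℕ} (L : Fin n → PLine) : Prop :=
  ∃ i j : Fin n, i ≠ j ∧ ∃ F : ℝ → Fin n → PLine,
    (∀ k, ContinuousLineFamily (fun t => F t k)) ∧
    F 0 = L ∧
    (∀ t ∈ Set.Ico (0:ℝ) 1, PairwiseSkew (F t)) ∧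
    F 1 i = F 1 j ∧
    (∀ k l : Fin n, k ≠ l → ¬(k = i ∧ l = j) → ¬(k = j ∧ l = i) → Skew (F 1 k) (F 1 l))

/-- The line spanned by a pair of vectors. -/
def lineOf (P : Fin 2 → V4) : PLine := span ℝ {P 0, P 1}

/-- The determinant of the four vectors of two pairs. -/
noncomputable def pdet (P Q : Fin 2 → V4) : ℝ := det2 (P 0) (P 1) (Q 0) (Q 1)

/-- Tuples of pairs of vectors spanning pairwise skew lines. -/
def skewFrames (n : ℕ) : Set (Fin n → Fin 2 → V4) :=
  {X | ∀ i j, i ≠ j → pdet (X i) (X j) ≠ 0}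

lemma det2_eq (a b c d : V4) : det2 a b c d =
    (a 0 * b 1 - a 1 * b 0) * (c 2 * d 3 - c 3 * d 2)
    - (a 0 * b 2 - a 2 * b 0) * (c 1 * d 3 - c 3 * d 1)
    + (a 0 * b 3 - a 3 * b 0) * (c 1 * d 2 - c 2 * d 1)
    + (a 1 * b 2 - a 2 * b 1) * (c 0 * d 3 - c 3 * d 0)
    - (a 1 * b 3 - a 3 * b 1) * (c 0 * d 2 - c 2 * d 0)
    + (a 2 * b 3 - a 3 * b 2) * (c 0 * d 1 - c 1 * d 0) := by
  simp [det2, Matrix.det_succ_row_zero, Fin.sum_univ_succ, Fin.succAbove, Matrix.submatrix]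
  ring

lemma pdet_comm (P Q : Fin 2 → V4) : pdet P Q = pdet Q P := by
  simp only [pdet, det2_eq]; ring

lemma pdet_self (P : Fin 2 → V4) : pdet P P = 0 := by
  simp only [pdet, det2_eq]; ring

lemma continuous_pdet : Continuous fun p : (Fin 2 → V4) × (Fin 2 → V4) => pdet p.1 p.2 := by
  simp only [pdet, det2_eq]; fun_prop

lemma continuousOn_pdet {f g : ℝ → Fin 2 → V4} {s : Set ℝ} (hf : ContinuousOn f s)
    (hg : ContinuousOn g s) : ContinuousOn (fun t => pdet (f t) (g t)) s := by
  have := continuous_pdet.comp_continuousOn (hf.prodMk hg)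
  exact this

lemma pdet_eq_mul_of_mem {P P' : Fin 2 → V4} (h : ∀ i, P' i ∈ lineOf P) :
    ∃ k : ℝ, ∀ Q, pdet P' Q = k * pdet P Q := by
  obtain ⟨a, b, hab⟩ := mem_span_pair.1 (h 0)
  obtain ⟨c, d, hcd⟩ := mem_span_pair.1 (h 1)
  refine ⟨a * d - b * c, fun Q => ?_⟩
  simp only [pdet, det2_eq, ← hab, ← hcd, Pi.add_apply, Pi.smul_apply, smul_eq_mul]
  ring

lemma mem_lineOf (P : Fin 2 → V4) (i : Fin 2) : P i ∈ lineOf P := by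
  fin_cases i
  · exact subset_span (by simp)
  · exact subset_span (by simp)

lemma sign_pdet_mul_eq {P P' Q Q' R R' : Fin 2 → V4} (hP : lineOf P = lineOf P')
    (hQ : lineOf Q = lineOf Q') (hR : lineOf R = lineOf R') :
    Real.sign (pdet P Q * pdet P R * pdet Q R) =
      Real.sign (pdet P' Q' * pdet P' R' * pdet Q' R') := by
  have key : ∀ {P P' Q Q' R R' : Fin 2 → V4}, lineOf P = lineOf P' → lineOf Q = lineOf Q' →
      lineOf R = lineOf R' → ∃ k : ℝ, pdet P Q * pdet P R * pdet Q R =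
        k ^ 2 * (pdet P' Q' * pdet P' R' * pdet Q' R') := by
    intro P P' Q Q' R R' hP hQ hR
    obtain ⟨a, ha⟩ := pdet_eq_mul_of_mem (fun i => hP ▸ mem_lineOf P i)
    obtain ⟨b, hb⟩ := pdet_eq_mul_of_mem (fun i => hQ ▸ mem_lineOf Q i)
    obtain ⟨c, hc⟩ := pdet_eq_mul_of_mem (fun i => hR ▸ mem_lineOf R i)
    refine ⟨a * b * c, ?_⟩
    rw [ha, ha, hb, pdet_comm P' Q, pdet_comm P' R, pdet_comm Q' R, hb, hc, hc,
      pdet_comm Q' P', pdet_comm R' P', pdet_comm R' Q']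
    ring
  obtain ⟨k, hk⟩ := key hP hQ hR
  obtain ⟨l, hl⟩ := key hP.symm hQ.symm hR.symm
  rcases eq_or_ne k 0 with rfl | hk0
  · simp only [ne_eq, OfNat.ofNat_ne_zero, not_false_eq_true, zero_pow, zero_mul] at hk
    rw [hk, mul_zero] at hl
    rw [hk, hl]
  · rw [hk]
    have : 0 < k ^ 2 := by positivity
    rcases lt_trichotomy (pdet P' Q' * pdet P' R' * pdet Q' R') 0 with h | h | h
    · rw [Real.sign_of_neg h, Real.sign_of_neg (mul_neg_of_pos_of_neg this h)]
    · rw [h, mul_zero]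
    · rw [Real.sign_of_pos h, Real.sign_of_pos (mul_pos this h)]

lemma lk_lineOf (P Q R : Fin 2 → V4) :
    lk (lineOf P) (lineOf Q) (lineOf R) = Real.sign (pdet P Q * pdet P R * pdet Q R) := by
  have h : ∃ v : Fin 6 → V4, lineOf P = span ℝ {v 0, v 1} ∧ lineOf Q = span ℝ {v 2, v 3} ∧
      lineOf R = span ℝ {v 4, v 5} :=
    ⟨![P 0, P 1, Q 0, Q 1, R 0, R 1], rfl, rfl, rfl⟩
  rw [lk, dif_pos h]
  obtain ⟨h1, h2, h3⟩ := h.choose_spec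
  exact (sign_pdet_mul_eq (P' := ![h.choose 0, h.choose 1]) (Q' := ![h.choose 2, h.choose 3])
    (R' := ![h.choose 4, h.choose 5]) h1 h2 h3).symm

lemma linearIndependent_of_pdet_ne_zero {P Q : Fin 2 → V4} (h : pdet P Q ≠ 0) :
    LinearIndependent ℝ ![P 0, P 1, Q 0, Q 1] := by
  have := (Matrix.linearIndependent_rows_iff_isUnit
    (A := Matrix.of ![P 0, P 1, Q 0, Q 1])).2
    ((Matrix.isUnit_iff_isUnit_det _).2 (isUnit_iff_ne_zero.2 h))
  exact this

lemma lineOf_eq_span_range (P : Fin 2 → V4) : lineOf P = span ℝ (Set.range ![P 0, P 1]) := by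
  rw [Matrix.range_cons_cons_empty, lineOf]

lemma skew_of_pdet_ne_zero {P Q : Fin 2 → V4} (h : pdet P Q ≠ 0) :
    Skew (lineOf P) (lineOf Q) := by
  have key : ∀ a b c d : ℝ, a • P 0 + b • P 1 + c • Q 0 + d • Q 1 = 0 →
      a = 0 ∧ b = 0 ∧ c = 0 ∧ d = 0 := by
    intro a b c d h0
    have := Fintype.linearIndependent_iff.1 (linearIndependent_of_pdet_ne_zero h) ![a, b, c, d]
      (by simpa [Fin.sum_univ_four] using h0)
    exact ⟨this 0, this 1, this 2, this 3⟩
  refine ⟨?_, ?_, ?_⟩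
  · have : LinearIndependent ℝ ![P 0, P 1] := LinearIndependent.pair_iff.2 fun s t hst => by
      have := key s t 0 0 (by simpa using hst)
      exact ⟨this.1, this.2.1⟩
    rw [IsLine, lineOf_eq_span_range, finrank_span_eq_card this, Fintype.card_fin]
  · have : LinearIndependent ℝ ![Q 0, Q 1] := LinearIndependent.pair_iff.2 fun s t hst => by
      have := key 0 0 s t (by simpa using hst)
      exact ⟨this.2.2.1, this.2.2.2⟩
    rw [IsLine, lineOf_eq_span_range, finrank_span_eq_card this, Fintype.card_fin]
  · rw [eq_bot_iff]
    rintro x ⟨hP, hQ⟩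
    obtain ⟨a, b, hab⟩ := mem_span_pair.1 hP
    obtain ⟨c, d, hcd⟩ := mem_span_pair.1 hQ
    have := key a b (-c) (-d) (by
      rw [hab, add_assoc, ← neg_inj]; simp only [neg_smul, neg_add_rev, neg_neg]
      rw [add_comm (d • _), hcd]; simp)
    simp [← hab, this.1, this.2.1]

lemma IsLine.exists_lineOf {P : PLine} (h : IsLine P) : ∃ X : Fin 2 → V4, P = lineOf X := by
  let b := Module.finBasisOfFinrankEq ℝ P h
  refine ⟨fun i => b i, ?_⟩
  have := congrArg (Submodule.map P.subtype) b.span_eq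
  rw [Submodule.map_span, Submodule.map_top, Submodule.range_subtype, ← Set.range_comp] at this
  refine this.symm.trans ?_
  rw [lineOf]
  congr 1
  ext x
  simp [Fin.exists_fin_two, eq_comm]

lemma linearIndependent_of_isLine {P : Fin 2 → V4} (h : IsLine (lineOf P)) (a b : ℝ)
    (hab : a • P 0 + b • P 1 = 0) : a = 0 ∧ b = 0 := by
  have : LinearIndependent ℝ ![P 0, P 1] := by
    rw [linearIndependent_iff_card_eq_finrank_span]
    rw [IsLine, lineOf_eq_span_range] at h
    rw [Set.finrank, h, Fintype.card_fin]
  exact LinearIndependent.pair_iff.1 this a b hab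

lemma pdet_ne_zero_of_skew {P Q : Fin 2 → V4} (h : Skew (lineOf P) (lineOf Q)) :
    pdet P Q ≠ 0 := by
  have : LinearIndependent ℝ ![P 0, P 1, Q 0, Q 1] := by
    rw [Fintype.linearIndependent_iff]
    intro g hg
    simp only [Fin.sum_univ_four] at hg
    change g 0 • P 0 + g 1 • P 1 + g 2 • Q 0 + g 3 • Q 1 = 0 at hg
    have hm : g 0 • P 0 + g 1 • P 1 ∈ lineOf P ⊓ lineOf Q := by
      refine ⟨mem_span_pair.2 ⟨_, _, rfl⟩, mem_span_pair.2 ⟨-g 2, -g 3, ?_⟩⟩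
      rw [← sub_eq_zero, ← neg_eq_zero, ← hg]
      module
    rw [h.2.2, mem_bot] at hm
    have h1 := linearIndependent_of_isLine h.1 _ _ hm
    rw [hm, zero_add] at hg
    have h2 := linearIndependent_of_isLine h.2.1 _ _ hg
    intro i
    fin_cases i
    exacts [h1.1, h1.2, h2.1, h2.2]
  have := (Matrix.linearIndependent_rows_iff_isUnit
    (A := Matrix.of ![P 0, P 1, Q 0, Q 1])).1 this
  exact ((Matrix.isUnit_iff_isUnit_det _).1 this).ne_zero

lemma pairwiseSkew_iff {n : ℕ} (X : Fin n → Fin 2 → V4) :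
    PairwiseSkew (fun i => lineOf (X i)) ↔ X ∈ skewFrames n :=
  ⟨fun h i j hij => pdet_ne_zero_of_skew (h i j hij),
    fun h i j hij => skew_of_pdet_ne_zero (h i j hij)⟩

lemma PairwiseSkew.exists_frames {n : ℕ} {L : Fin (n + 2) → PLine} (hL : PairwiseSkew L) :
    ∃ X ∈ skewFrames (n + 2), L = fun i => lineOf (X i) := by
  have : ∀ i, ∃ X, L i = lineOf X := fun i => by
    obtain ⟨j, hj⟩ := exists_ne i
    exact (hL i j hj.symm).1.exists_lineOf
  choose X hX using this
  have hLX : L = fun i => lineOf (X i) := funext hX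
  exact ⟨X, (pairwiseSkew_iff X).1 (hLX ▸ hL), hLX⟩

lemma deformation_of_joinedIn {n : ℕ} {X Y : Fin n → Fin 2 → V4}
    (h : JoinedIn (skewFrames n) X Y) :
    Deformation (fun i => lineOf (X i)) (fun i => lineOf (Y i)) := by
  obtain ⟨γ, hγ⟩ := h
  refine ⟨fun t i => lineOf (γ.extend t i), fun i => ⟨fun t => γ.extend t i 0,
    fun t => γ.extend t i 1, ?_, ?_, fun _ _ => rfl⟩, fun t ht => ?_, ?_, ?_⟩
  · exact (by fun_prop : Continuous fun t => γ.extend t i 0).continuousOn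
  · exact (by fun_prop : Continuous fun t => γ.extend t i 1).continuousOn
  · rw [pairwiseSkew_iff, γ.extend_apply ht]
    exact hγ _
  · simp
  · simp

lemma sign_eq_of_continuousOn {f : ℝ → ℝ} (hf : ContinuousOn f (Set.Icc 0 1))
    (hf0 : ∀ t ∈ Set.Icc (0 : ℝ) 1, f t ≠ 0) : Real.sign (f 0) = Real.sign (f 1) := by
  rcases lt_or_gt_of_ne (hf0 0 (by simp)) with a | a <;>
    rcases lt_or_gt_of_ne (hf0 1 (by simp)) with b | b
  · rw [Real.sign_of_neg a, Real.sign_of_neg b]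
  · obtain ⟨t, ht, h⟩ := intermediate_value_Icc zero_le_one hf ⟨a.le, b.le⟩
    exact absurd h (hf0 t ht)
  · obtain ⟨t, ht, h⟩ := intermediate_value_Icc' zero_le_one hf ⟨b.le, a.le⟩
    exact absurd h (hf0 t ht)
  · rw [Real.sign_of_pos a, Real.sign_of_pos b]

lemma lk_eq_of_deformation {n : ℕ} {L L' : Fin n → PLine} (h : Deformation L L')
    {i j k : Fin n} (hij : i ≠ j) (hik : i ≠ k) (hjk : j ≠ k) :
    lk (L i) (L j) (L k) = lk (L' i) (L' j) (L' k) := by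
  obtain ⟨F, hF, hs, h0, h1⟩ := h
  choose v w hv hw hvw using hF
  have hF' : ∀ i, ∃ X : ℝ → Fin 2 → V4, ContinuousOn X (Set.Icc 0 1) ∧
      ∀ t ∈ Set.Icc (0 : ℝ) 1, F t i = lineOf (X t) := by
    refine fun i => ⟨fun t => ![v i t, w i t], continuousOn_pi.2 fun a => ?_, hvw i⟩
    fin_cases a
    exacts [hv i, hw i]
  choose X hX hFX using hF'
  have hne : ∀ i j, i ≠ j → ∀ t ∈ Set.Icc (0 : ℝ) 1, pdet (X i t) (X j t) ≠ 0 := by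
    intro i j hij t ht
    have := hs t ht i j hij
    rw [hFX i t ht, hFX j t ht] at this
    exact pdet_ne_zero_of_skew this
  have hc : ∀ i j, ContinuousOn (fun t => pdet (X i t) (X j t)) (Set.Icc 0 1) := fun i j =>
    continuousOn_pdet (hX i) (hX j)
  rw [← h0, ← h1, hFX i 0 (by simp), hFX j 0 (by simp), hFX k 0 (by simp), hFX i 1 (by simp),
    hFX j 1 (by simp), hFX k 1 (by simp), lk_lineOf, lk_lineOf]
  exact sign_eq_of_continuousOn (((hc i j).mul (hc i k)).mul (hc j k)) fun t ht =>
    mul_ne_zero (mul_ne_zero (hne _ _ hij t ht) (hne _ _ hik t ht)) (hne _ _ hjk t ht)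

section

variable {ι : Type*} [Fintype ι] [DecidableEq ι]

lemma joinedIn_of_continuous {X : Type*} [TopologicalSpace X] {S : Set X} (f : ℝ → X)
    (hf : ContinuousOn f (Set.Icc 0 1)) (hS : ∀ t ∈ Set.Icc (0 : ℝ) 1, f t ∈ S) :
    JoinedIn S (f 0) (f 1) :=
  JoinedIn.ofLine hf rfl rfl (Set.image_subset_iff.2 hS)

lemma det_reflection {u : ι → ℝ} (hu : u ⬝ᵥ u ≠ 0) :
    (1 - (2 / (u ⬝ᵥ u)) • Matrix.vecMulVec u u).det = -1 := by
  have := Matrix.det_one_add_replicateCol_mul_replicateRow (ι := Unit)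
    (-(2 / (u ⬝ᵥ u)) • u) u
  rw [← Matrix.vecMulVec_eq, Matrix.smul_vecMulVec, neg_smul, ← sub_eq_add_neg] at this
  rw [this, dotProduct_smul, smul_eq_mul]
  field_simp
  norm_num

lemma diagonal_mulSingle_neg_one (i : ι) :
    Matrix.diagonal (Pi.mulSingle i (-1 : ℝ)) =
      1 - (2 / ((Pi.single i 1 : ι → ℝ) ⬝ᵥ Pi.single i 1)) •
        Matrix.vecMulVec (Pi.single i 1) (Pi.single i 1) := by
  ext a b
  rcases eq_or_ne a b with rfl | hab
  · rcases eq_or_ne a i with rfl | hai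
    · simp [Matrix.vecMulVec_apply]; norm_num
    · simp [Matrix.vecMulVec_apply, hai]
  · rcases eq_or_ne a i with rfl | hai
    · simp [Matrix.vecMulVec_apply, hab, hab.symm]
    · simp [Matrix.vecMulVec_apply, hab, hai]

lemma joinedIn_diagonal_mulSingle_neg_one (i j : ι) :
    JoinedIn {A : Matrix ι ι ℝ | A.det ≠ 0} (Matrix.diagonal (Pi.mulSingle i (-1)))
      (Matrix.diagonal (Pi.mulSingle j (-1))) := by
  rcases eq_or_ne i j with rfl | hij
  · exact JoinedIn.refl (by simp [Matrix.det_diagonal, Pi.mulSingle_apply, Finset.prod_ite_eq'])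
  let u : ℝ → ι → ℝ := fun t => Pi.single i (1 - t) + Pi.single j t
  have hu : ∀ t, u t ⬝ᵥ u t ≠ 0 := fun t => by
    have : u t ⬝ᵥ u t = (1 - t) ^ 2 + t ^ 2 := by
      simp [u, dotProduct_add, hij, hij.symm, sq]
    rw [this]
    nlinarith [sq_nonneg (2 * t - 1)]
  have := joinedIn_of_continuous (S := {A : Matrix ι ι ℝ | A.det ≠ 0})
    (fun t => 1 - (2 / (u t ⬝ᵥ u t)) • Matrix.vecMulVec (u t) (u t)) ?_ fun t _ => ?_
  · rw [diagonal_mulSingle_neg_one, diagonal_mulSingle_neg_one]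
    simpa [u] using this
  · have hc : Continuous u := by
      refine continuous_pi fun a => ?_
      simp only [u, Pi.add_apply, Pi.single_apply]
      split_ifs <;> fun_prop
    refine Continuous.continuousOn (continuous_const.sub (Continuous.fun_smul ?_ ?_))
    · exact continuous_const.div (hc.dotProduct hc) hu
    · exact hc.matrix_vecMulVec hc
  · simp [det_reflection (hu t)]

open scoped Pointwise in
lemma joinedIn_det_ne_zero (i₀ : ι) (A : Matrix ι ι ℝ) (hA : A.det ≠ 0) :
    JoinedIn {A : Matrix ι ι ℝ | A.det ≠ 0} A 1 ∨
      JoinedIn {A : Matrix ι ι ℝ | A.det ≠ 0} A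
        (Matrix.diagonal (Pi.mulSingle i₀ (-1))) := by
  set S : Set (Matrix ι ι ℝ) := {A | A.det ≠ 0} with hS
  have hRR : Matrix.diagonal (Pi.mulSingle i₀ (-1 : ℝ)) * Matrix.diagonal (Pi.mulSingle i₀ (-1)) =
      1 := by
    rw [Matrix.diagonal_mul_diagonal, ← Matrix.diagonal_one]
    congr 1
    ext a
    rw [Pi.mulSingle_apply]
    split_ifs <;> norm_num
  have hSS : S * S ⊆ S := by
    rintro _ ⟨a, ha, b, hb, rfl⟩
    simp only [hS, Set.mem_ofPred_eq, Matrix.det_mul] at *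
    exact mul_ne_zero ha hb
  have hmul : ∀ A B : Matrix ι ι ℝ,
      (JoinedIn S A 1 ∨ JoinedIn S A (Matrix.diagonal (Pi.mulSingle i₀ (-1)))) →
      (JoinedIn S B 1 ∨ JoinedIn S B (Matrix.diagonal (Pi.mulSingle i₀ (-1)))) →
      (JoinedIn S (A * B) 1 ∨ JoinedIn S (A * B) (Matrix.diagonal (Pi.mulSingle i₀ (-1)))) := by
    rintro A B (hA | hA) (hB | hB) <;> have h := (hA.mul hB).mono hSS
    · exact Or.inl (by simpa using h)
    · exact Or.inr (by simpa using h)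
    · exact Or.inr (by simpa using h)
    · exact Or.inl (by rwa [hRR] at h)
  refine Matrix.diagonal_transvection_induction_of_det_ne_zero _ A hA (fun d hd => ?_)
    (fun t => ?_) (fun A B _ _ => hmul A B)
  · rw [Matrix.det_diagonal, Finset.prod_ne_zero_iff] at hd
    rw [← Finset.univ_prod_mulSingle d]
    refine Finset.prod_induction (fun i => Pi.mulSingle i (d i))
      (fun d => JoinedIn S (Matrix.diagonal d) 1 ∨
        JoinedIn S (Matrix.diagonal d) (Matrix.diagonal (Pi.mulSingle i₀ (-1))))
      (fun a b ha hb => ?_) ?_ fun i hi => ?_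
    · have := hmul _ _ ha hb
      rwa [Matrix.diagonal_mul_diagonal'] at this
    · exact Or.inl (by simpa using JoinedIn.refl (by simp [hS]))
    · have key : ∀ e : ℝ, 0 < d i * e → JoinedIn S (Matrix.diagonal (Pi.mulSingle i (d i)))
          (Matrix.diagonal (Pi.mulSingle i e)) := by
        intro e he
        have := joinedIn_of_continuous (S := S)
          (fun t => Matrix.diagonal (Pi.mulSingle i ((1 - t) * d i + t * e))) ?_ fun t ht => ?_
        · simpa using this
        · refine (Continuous.matrix_diagonal (continuous_pi fun a => ?_)).continuousOn
          simp only [Pi.mulSingle_apply]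
          split_ifs <;> fun_prop
        · simp only [hS, Set.mem_ofPred_eq, Matrix.det_diagonal, Pi.mulSingle_apply,
            Finset.prod_ite_eq', Finset.mem_univ, if_true]
          intro h0
          have h1 := ht.1
          have h2 := sub_nonneg.2 ht.2
          have h3 : 0 < d i * d i := mul_self_pos.2 (hd i hi)
          have : ((1 - t) * d i + t * e) * d i = 0 := by rw [h0, zero_mul]
          nlinarith [mul_nonneg h1 he.le, mul_nonneg h2 h3.le, mul_nonneg h1 h2]
      rcases lt_or_gt_of_ne (hd i hi) with h | h
      · exact Or.inr ((key (-1) (by linarith)).trans (joinedIn_diagonal_mulSingle_neg_one i i₀))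
      · exact Or.inl (by simpa using key 1 (by linarith))
  · refine Or.inl ?_
    have := joinedIn_of_continuous (S := S)
      (fun s => Matrix.transvection t.i t.j ((1 - s) * t.c)) ?_ fun s _ => ?_
    · simpa [Matrix.TransvectionStruct.toMatrix] using this
    · refine Continuous.continuousOn (continuous_const.add ?_)
      refine continuous_pi fun a => continuous_pi fun b => ?_
      simp only [Matrix.single_apply]
      split_ifs <;> fun_prop
    · simp [hS, Matrix.det_transvection_of_ne _ _ t.hij]

lemma joinedIn_one_of_det_pos [Nonempty ι] (A : Matrix ι ι ℝ) (hA : 0 < A.det) :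
    JoinedIn {A : Matrix ι ι ℝ | A.det ≠ 0} A 1 := by
  obtain ⟨i₀⟩ := ‹Nonempty ι›
  refine (joinedIn_det_ne_zero i₀ A hA.ne').resolve_right fun ⟨γ, hγ⟩ => ?_
  have := sign_eq_of_continuousOn (f := fun t => (γ.extend t).det)
    (by fun_prop : Continuous fun t => (γ.extend t).det).continuousOn fun t ht => by
      rw [γ.extend_apply ht]; exact hγ _
  simp only [γ.extend_zero, γ.extend_one, Real.sign_of_pos hA, Matrix.det_diagonal,
    Pi.mulSingle_apply, Finset.prod_ite_eq', Finset.mem_univ, if_true, Real.sign_neg,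
    Real.sign_one] at this
  norm_num at this

end

open scoped Matrix

lemma pdet_mulVec (A : Matrix (Fin 4) (Fin 4) ℝ) (P Q : Fin 2 → V4) :
    pdet (fun k => A *ᵥ P k) (fun k => A *ᵥ Q k) = A.det * pdet P Q := by
  have : Matrix.of ![A *ᵥ P 0, A *ᵥ P 1, A *ᵥ Q 0, A *ᵥ Q 1] =
      Matrix.of ![P 0, P 1, Q 0, Q 1] * Aᵀ := by
    ext i j
    rw [Matrix.mul_apply]
    fin_cases i <;> simp [Matrix.mulVec, dotProduct, mul_comm]
  rw [pdet, det2, this, Matrix.det_mul, Matrix.det_transpose, mul_comm, pdet, det2]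

lemma lineOf_mulVec (A : Matrix (Fin 4) (Fin 4) ℝ) (P : Fin 2 → V4) :
    lineOf (fun k => A *ᵥ P k) = (lineOf P).map A.mulVecLin := by
  simp [lineOf, Submodule.map_span, Set.image_pair]

lemma joinedIn_mulVec {n : ℕ} {X : Fin n → Fin 2 → V4} (hX : X ∈ skewFrames n)
    {A : Matrix (Fin 4) (Fin 4) ℝ} (hA : 0 < A.det) :
    JoinedIn (skewFrames n) (fun i k => A *ᵥ X i k) X := by
  have h := (joinedIn_one_of_det_pos A hA).map
    (f := fun B : Matrix (Fin 4) (Fin 4) ℝ => fun i k => B *ᵥ X i k) (by fun_prop)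
  simp only [Matrix.one_mulVec] at h
  refine h.mono ?_
  rintro _ ⟨B, hB, rfl⟩ i j hij
  rw [pdet_mulVec]
  exact mul_ne_zero hB (hX i j hij)

/-- A basis of the graph of a linear map `ℝ² → ℝ²`. -/
def graphPair (M : Matrix (Fin 2) (Fin 2) ℝ) : Fin 2 → V4 :=
  ![![1, 0, M 0 0, M 1 0], ![0, 1, M 0 1, M 1 1]]

/-- A basis of the vertical subspace `0 × ℝ²`. -/
def verticalPair : Fin 2 → V4 := ![![0, 0, 1, 0], ![0, 0, 0, 1]]

/-- The vertical line followed by the graphs of the given matrices. -/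
def graphConfig {n : ℕ} (M : Fin n → Matrix (Fin 2) (Fin 2) ℝ) : Fin (n + 1) → Fin 2 → V4 :=
  Fin.cons verticalPair fun i => graphPair (M i)

/-- Tuples of matrices with pairwise invertible differences. -/
def separatedMatrices (n : ℕ) : Set (Fin n → Matrix (Fin 2) (Fin 2) ℝ) :=
  {M | ∀ i j, i ≠ j → (M i - M j).det ≠ 0}

lemma det_sub_comm (M N : Matrix (Fin 2) (Fin 2) ℝ) : (M - N).det = (N - M).det := by
  rw [← neg_sub, Matrix.det_neg]; simp

lemma pdet_graphPair (M N : Matrix (Fin 2) (Fin 2) ℝ) :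
    pdet (graphPair M) (graphPair N) = (M - N).det := by
  simp [pdet, det2_eq, graphPair, Matrix.det_fin_two]; ring

lemma pdet_verticalPair_graphPair (M : Matrix (Fin 2) (Fin 2) ℝ) :
    pdet verticalPair (graphPair M) = 1 := by
  simp [pdet, det2_eq, graphPair, verticalPair]

lemma graphConfig_mem {n : ℕ} {M : Fin n → Matrix (Fin 2) (Fin 2) ℝ}
    (hM : M ∈ separatedMatrices n) : graphConfig M ∈ skewFrames (n + 1) := by
  intro i j hij
  refine Fin.cases ?_ (fun i => ?_) i j hij <;> intro j <;> refine Fin.cases ?_ (fun j => ?_) j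
  · exact fun h => absurd rfl h
  · intro _
    simp [graphConfig, pdet_verticalPair_graphPair]
  · intro _
    simp [graphConfig, pdet_comm _ verticalPair, pdet_verticalPair_graphPair]
  · intro h
    simpa [graphConfig, pdet_graphPair] using hM i j (by simpa using h)

lemma continuous_graphConfig {n : ℕ} : Continuous (graphConfig (n := n)) := by
  refine continuous_pi fun i => ?_
  refine Fin.cases ?_ (fun i => ?_) i
  · exact continuous_const
  · refine continuous_pi fun k => continuous_pi fun a => ?_
    simp only [graphConfig, Fin.cons_succ]
    fin_cases k <;> fin_cases a <;> simp [graphPair] <;> fun_prop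

lemma JoinedIn.graphConfig {n : ℕ} {M N : Fin n → Matrix (Fin 2) (Fin 2) ℝ}
    (h : JoinedIn (separatedMatrices n) M N) :
    JoinedIn (skewFrames (n + 1)) (graphConfig M) (graphConfig N) := by
  refine (h.map continuous_graphConfig).mono ?_
  rintro _ ⟨B, hB, rfl⟩
  exact graphConfig_mem hB

/-- The configuration is the image under an invertible matrix of a vertical line and graphs. -/
def HasGraphForm {n : ℕ} (L : Fin (n + 1) → PLine) (A : Matrix (Fin 4) (Fin 4) ℝ)
    (M : Fin n → Matrix (Fin 2) (Fin 2) ℝ) : Prop :=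
  A.det ≠ 0 ∧ ∀ i, L i = lineOf fun k => A *ᵥ graphConfig M i k

lemma IsLine.eq_of_le {P Q : PLine} (hP : IsLine P) (hQ : IsLine Q) (h : P ≤ Q) : P = Q :=
  Submodule.eq_of_le_of_finrank_eq h (hP.trans hQ.symm)

lemma IsLine.eq_lineOf_graphPair {P : PLine} (hP : IsLine P) {A : Matrix (Fin 4) (Fin 4) ℝ}
    (hA : A.det ≠ 0) {M : Matrix (Fin 2) (Fin 2) ℝ} (h : ∀ k, A *ᵥ graphPair M k ∈ P) :
    P = lineOf fun k => A *ᵥ graphPair M k := by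
  refine (IsLine.eq_of_le ?_ hP ?_).symm
  · refine (skew_of_pdet_ne_zero (P := fun k => A *ᵥ verticalPair k) ?_).2.1
    rwa [pdet_mulVec, pdet_verticalPair_graphPair, mul_one]
  · exact span_le.2 (Set.pair_subset (h 0) (h 1))

lemma IsLine.eq_lineOf_verticalPair {P : PLine} (hP : IsLine P) {A : Matrix (Fin 4) (Fin 4) ℝ}
    (hA : A.det ≠ 0) (h : ∀ k, A *ᵥ verticalPair k ∈ P) :
    P = lineOf fun k => A *ᵥ verticalPair k := by
  refine (IsLine.eq_of_le ?_ hP ?_).symm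
  · refine (skew_of_pdet_ne_zero (Q := fun k => A *ᵥ graphPair 0 k) ?_).1
    rwa [pdet_mulVec, pdet_verticalPair_graphPair, mul_one]
  · exact span_le.2 (Set.pair_subset (h 0) (h 1))

lemma Skew.exists_add {P Q : PLine} (h : Skew P Q) (x : V4) : ∃ p ∈ P, x + p ∈ Q := by
  have htop : P ⊔ Q = ⊤ := by
    refine Submodule.eq_top_of_finrank_eq ?_
    have := Submodule.finrank_sup_add_finrank_inf_eq P Q
    rw [h.2.2, h.1, h.2.1, finrank_bot] at this
    simpa using this
  obtain ⟨p, hp, q, hq, rfl⟩ := Submodule.mem_sup.1 (htop ▸ mem_top : x ∈ P ⊔ Q)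
  exact ⟨-p, neg_mem hp, by simpa [add_comm] using hq⟩

lemma PairwiseSkew.exists_hasGraphForm {L : Fin 5 → PLine} (hL : PairwiseSkew L) :
    ∃ A M, HasGraphForm L A M ∧ M 0 = 0 ∧ M 1 = 1 := by
  have h10 : Skew (L 1) (L 0) := hL 1 0 (by decide)
  obtain ⟨e, he⟩ := h10.1.exists_lineOf
  have h02 : Skew (L 0) (L 2) := hL 0 2 (by decide)
  choose f hf0 hf2 using fun k => h02.exists_add (e k)
  have hf : L 0 = lineOf f := by
    refine (IsLine.eq_of_le ?_ h10.2.1 (span_le.2 (Set.pair_subset (hf0 0) (hf0 1)))).symm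
    have : LinearIndependent ℝ ![f 0, f 1] := LinearIndependent.pair_iff.2 fun s t hst => by
      refine linearIndependent_of_isLine (he ▸ h10.1) s t ?_
      have hmem : s • e 0 + t • e 1 ∈ L 1 ⊓ L 2 := by
        refine ⟨?_, ?_⟩
        · rw [he]
          exact mem_span_pair.2 ⟨s, t, rfl⟩
        · have := add_mem (smul_mem (L 2) s (hf2 0)) (smul_mem (L 2) t (hf2 1))
          rwa [smul_add, smul_add, add_add_add_comm, hst, add_zero] at this
      rwa [(hL 1 2 (by decide)).2.2, mem_bot] at hmem
    change IsLine (lineOf f)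
    rw [IsLine, lineOf_eq_span_range, finrank_span_eq_card this, Fintype.card_fin]
  let A : Matrix (Fin 4) (Fin 4) ℝ := (Matrix.of ![e 0, e 1, f 0, f 1])ᵀ
  have hA : A.det ≠ 0 := by
    rw [Matrix.det_transpose]
    rw [he, hf] at h10
    exact pdet_ne_zero_of_skew h10
  have hAv : ∀ k, A *ᵥ verticalPair k = f k := by
    intro k
    ext a
    fin_cases k <;> simp [A, Matrix.mulVec, dotProduct, Fin.sum_univ_four, verticalPair]
  have hAg : ∀ M k, A *ᵥ graphPair M k = e k + (M 0 k • f 0 + M 1 k • f 1) := by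
    intro M k
    ext a
    fin_cases k <;>
      simp [A, Matrix.mulVec, dotProduct, Fin.sum_univ_four, graphPair] <;> ring
  have hex : ∀ i : Fin 4, ∃ M, (L i.succ = lineOf fun k => A *ᵥ graphPair M k) ∧
      (i = 0 → M = 0) ∧ (i = 1 → M = 1) := by
    intro i
    have hi : Skew (L 0) (L i.succ) := hL _ _ (Fin.succ_ne_zero i).symm
    by_cases hi0 : i = 0
    · subst hi0
      refine ⟨0, hi.2.1.eq_lineOf_graphPair hA fun k => ?_, fun _ => rfl, fun h => by simp at h⟩
      rw [hAg]
      simpa [he] using mem_lineOf e k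
    by_cases hi1 : i = 1
    · subst hi1
      refine ⟨1, hi.2.1.eq_lineOf_graphPair hA (Fin.forall_fin_two.2 ⟨?_, ?_⟩),
        fun h => by simp at h, fun _ => rfl⟩
      · rw [hAg]; simpa using hf2 0
      · rw [hAg]; simpa using hf2 1
    choose g hg0 hg using fun k => hi.exists_add (e k)
    choose a b hab using fun k => mem_span_pair.1 (hf ▸ hg0 k : g k ∈ lineOf f)
    refine ⟨Matrix.of ![a, b], hi.2.1.eq_lineOf_graphPair hA fun k => ?_,
      fun h => absurd h hi0, fun h => absurd h hi1⟩
    rw [hAg]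
    simpa [hab] using hg k
  choose M hM hM0 hM1 using hex
  refine ⟨A, M, ⟨hA, fun i => ?_⟩, hM0 0 rfl, hM1 1 rfl⟩
  refine Fin.cases ?_ (fun i => hM i) i
  exact h10.2.1.eq_lineOf_verticalPair hA fun k => by rw [hAv]; exact hf0 k

lemma HasGraphForm.lk_zero {n : ℕ} {L : Fin (n + 1) → PLine} {A : Matrix (Fin 4) (Fin 4) ℝ}
    {M : Fin n → Matrix (Fin 2) (Fin 2) ℝ} (h : HasGraphForm L A M) (i j : Fin n) :
    lk (L 0) (L i.succ) (L j.succ) = Real.sign (A.det * (M i - M j).det) := by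
  rw [h.2, h.2, h.2, lk_lineOf, pdet_mulVec, pdet_mulVec, pdet_mulVec]
  simp only [graphConfig, Fin.cons_zero, Fin.cons_succ, pdet_verticalPair_graphPair,
    pdet_graphPair]
  have hA : 0 < A.det ^ 2 := by have := h.1; positivity
  rw [show A.det * 1 * (A.det * 1) * (A.det * (M i - M j).det) =
    A.det ^ 2 * (A.det * (M i - M j).det) by ring]
  rcases lt_trichotomy (A.det * (M i - M j).det) 0 with h | h | h
  · rw [Real.sign_of_neg h, Real.sign_of_neg (mul_neg_of_pos_of_neg hA h)]
  · rw [h, mul_zero]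
  · rw [Real.sign_of_pos h, Real.sign_of_pos (mul_pos hA h)]

lemma HasGraphForm.mem_separatedMatrices {n : ℕ} {L : Fin (n + 1) → PLine}
    {A : Matrix (Fin 4) (Fin 4) ℝ} {M : Fin n → Matrix (Fin 2) (Fin 2) ℝ}
    (h : HasGraphForm L A M) (hL : PairwiseSkew L) : M ∈ separatedMatrices n := by
  intro i j hij h0
  have := hL i.succ j.succ (by simpa using hij)
  rw [h.2, h.2] at this
  have := pdet_ne_zero_of_skew this
  rw [pdet_mulVec] at this
  simp [graphConfig, pdet_graphPair, h0] at this

lemma HasGraphForm.deformation {n : ℕ} {L L' : Fin (n + 1) → PLine}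
    {A A' : Matrix (Fin 4) (Fin 4) ℝ} {M M' : Fin n → Matrix (Fin 2) (Fin 2) ℝ}
    (h : HasGraphForm L A M) (h' : HasGraphForm L' A' M') (hA : 0 < A.det) (hA' : 0 < A'.det)
    (hM : JoinedIn (separatedMatrices n) M M') : Deformation L L' := by
  rw [show L = _ from funext h.2, show L' = _ from funext h'.2]
  exact deformation_of_joinedIn (((joinedIn_mulVec (graphConfig_mem hM.mem.1) hA).trans
    hM.graphConfig).trans (joinedIn_mulVec (graphConfig_mem hM.mem.2) hA').symm)

/-- The matrix acting as `S` on both factors of `ℝ² × ℝ²`. -/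
def doubleMatrix (S : Matrix (Fin 2) (Fin 2) ℝ) : Matrix (Fin 4) (Fin 4) ℝ :=
  !![S 0 0, S 0 1, 0, 0; S 1 0, S 1 1, 0, 0; 0, 0, S 0 0, S 0 1; 0, 0, S 1 0, S 1 1]

lemma det_doubleMatrix (S : Matrix (Fin 2) (Fin 2) ℝ) : (doubleMatrix S).det = S.det ^ 2 := by
  simp [doubleMatrix, Matrix.det_succ_row_zero, Fin.sum_univ_succ, Fin.succAbove]
  ring

lemma lineOf_graphPair_conj {S M M' : Matrix (Fin 2) (Fin 2) ℝ} (hS : S.det ≠ 0)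
    (h : M * S = S * M') :
    lineOf (graphPair M) = lineOf fun k => doubleMatrix S *ᵥ graphPair M' k := by
  refine IsLine.eq_lineOf_graphPair (skew_of_pdet_ne_zero (P := verticalPair) ?_).2.1
    (by rw [det_doubleMatrix]; positivity) fun k => mem_span_pair.2 ⟨S 0 k, S 1 k, ?_⟩
  · rw [pdet_verticalPair_graphPair]; exact one_ne_zero
  · have h' := fun i j => congrFun (congrFun h i) j
    simp only [Matrix.mul_apply, Fin.sum_univ_two] at h'
    ext a
    have h0 := h' 0 k
    have h1 := h' 1 k
    fin_cases k <;> fin_cases a <;>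
      simp [graphPair, doubleMatrix, Matrix.mulVec, dotProduct, Fin.sum_univ_four] at * <;>
      linarith

lemma lineOf_verticalPair_conj {S : Matrix (Fin 2) (Fin 2) ℝ} (hS : S.det ≠ 0) :
    lineOf verticalPair = lineOf fun k => doubleMatrix S *ᵥ verticalPair k := by
  refine IsLine.eq_lineOf_verticalPair (skew_of_pdet_ne_zero (Q := graphPair 0) ?_).1
    (by rw [det_doubleMatrix]; positivity) fun k => mem_span_pair.2 ⟨S 0 k, S 1 k, ?_⟩
  · rw [pdet_verticalPair_graphPair]; exact one_ne_zero
  · ext a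
    fin_cases k <;> fin_cases a <;>
      simp [verticalPair, doubleMatrix, Matrix.mulVec, dotProduct, Fin.sum_univ_four]

lemma HasGraphForm.conj {n : ℕ} {L : Fin (n + 1) → PLine} {A : Matrix (Fin 4) (Fin 4) ℝ}
    {M M' : Fin n → Matrix (Fin 2) (Fin 2) ℝ} (h : HasGraphForm L A M)
    {S : Matrix (Fin 2) (Fin 2) ℝ} (hS : S.det ≠ 0) (hM : ∀ i, M i * S = S * M' i) :
    HasGraphForm L (A * doubleMatrix S) M' := by
  refine ⟨?_, fun i => ?_⟩
  · rw [Matrix.det_mul, det_doubleMatrix]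
    exact mul_ne_zero h.1 (by positivity)
  · have : lineOf (graphConfig M i) = lineOf fun k => doubleMatrix S *ᵥ graphConfig M' i k := by
      refine Fin.cases ?_ (fun i => ?_) i
      · exact lineOf_verticalPair_conj hS
      · exact lineOf_graphPair_conj hS (hM i)
    rw [h.2, lineOf_mulVec, this, ← lineOf_mulVec]
    simp only [Matrix.mulVec_mulVec]

lemma exists_mul_eq_mul_diagonal {N : Matrix (Fin 2) (Fin 2) ℝ} (hN : N.det < 0) :
    ∃ (S : Matrix (Fin 2) (Fin 2) ℝ) (μ ν : ℝ), S.det ≠ 0 ∧ 0 < μ ∧ ν < 0 ∧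
      N * S = S * !![μ, 0; 0, ν] := by
  obtain ⟨a, b, c, d, rfl⟩ : ∃ a b c d : ℝ, N = !![a, b; c, d] := ⟨_, _, _, _, N.eta_fin_two⟩
  rw [Matrix.det_fin_two_of] at hN
  have hD : 0 < (a + d) ^ 2 - 4 * (a * d - b * c) := by nlinarith [sq_nonneg (a + d)]
  set r := √((a + d) ^ 2 - 4 * (a * d - b * c)) with hr
  have hr0 : 0 < r := Real.sqrt_pos.2 hD
  have hr2 : r ^ 2 = (a + d) ^ 2 - 4 * (a * d - b * c) := Real.sq_sqrt hD.le
  obtain ⟨μ, hμ⟩ : ∃ μ, μ = (a + d + r) / 2 := ⟨_, rfl⟩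
  obtain ⟨ν, hν⟩ : ∃ ν, ν = (a + d - r) / 2 := ⟨_, rfl⟩
  have hsum : μ + ν = a + d := by rw [hμ, hν]; ring
  have hmul : μ * ν = a * d - b * c := by rw [hμ, hν]; linear_combination -hr2 / 4
  have hlt : ν < μ := by rw [hμ, hν]; linarith
  have hμ0 : 0 < μ := by
    by_contra! h
    nlinarith [mul_nonneg_of_nonpos_of_nonpos h (hlt.le.trans h)]
  have hν0 : ν < 0 := by
    by_contra! h
    nlinarith [mul_nonneg hμ0.le h]
  have hsub : ν - μ ≠ 0 := (sub_neg.2 hlt).ne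
  have hchar : ∀ x, x = μ ∨ x = ν → (x - a) * (x - d) = b * c := by
    rintro x (rfl | rfl) <;> linear_combination x * hsum - hmul
  have h1 := hchar μ (.inl rfl)
  have h2 := hchar ν (.inr rfl)
  by_cases hb : b = 0
  · by_cases hc : c = 0
    · subst hb hc
      rcases lt_or_ge a 0 with ha | ha
      · exact ⟨!![0, 1; 1, 0], d, a, by simp, by nlinarith, ha, by simp⟩
      · exact ⟨1, a, d, by simp, by nlinarith [ha.lt_of_ne (by rintro rfl; simp at hN)],
          by nlinarith, by simp⟩
    · refine ⟨!![μ - d, ν - d; c, c], μ, ν, ?_, hμ0, hν0, ?_⟩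
      · rw [Matrix.det_fin_two_of, show (μ - d) * c - (ν - d) * c = -(c * (ν - μ)) by ring]
        exact neg_ne_zero.2 (mul_ne_zero hc hsub)
      · ext i j
        fin_cases i <;> fin_cases j <;> simp <;> linarith
  · refine ⟨!![b, b; μ - a, ν - a], μ, ν, ?_, hμ0, hν0, ?_⟩
    · rw [Matrix.det_fin_two_of, show b * (ν - a) - b * (μ - a) = b * (ν - μ) by ring]
      exact mul_ne_zero hb hsub
    · ext i j
      fin_cases i <;> fin_cases j <;> simp <;> linarith

/-- The zero, identity and a diagonal matrix followed by a fourth matrix. -/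
def normalTuple (μ ν : ℝ) (N : Matrix (Fin 2) (Fin 2) ℝ) : Fin 4 → Matrix (Fin 2) (Fin 2) ℝ :=
  ![0, 1, !![μ, 0; 0, ν], N]

lemma normalTuple_mem {μ ν : ℝ} {N : Matrix (Fin 2) (Fin 2) ℝ} (hμ : 0 < μ) (hν : ν < 0)
    (hμ1 : 1 - μ ≠ 0) (h0 : N.det ≠ 0) (h1 : (N - 1).det ≠ 0)
    (h2 : (N - !![μ, 0; 0, ν]).det ≠ 0) : normalTuple μ ν N ∈ separatedMatrices 4 := by
  have key : ∀ i j, i < j → (normalTuple μ ν N j - normalTuple μ ν N i).det ≠ 0 := by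
    have hν1 : ν - 1 ≠ 0 := by linarith
    have hμ1' : μ - 1 ≠ 0 := fun h => hμ1 (by linarith)
    intro i j hij
    fin_cases i <;> fin_cases j <;> first
      | exact absurd hij (by decide)
      | assumption
      | (simp [normalTuple, Matrix.det_fin_two, hμ.ne', hν.ne, hν1, hμ1'] at *; try assumption)
  intro i j hij
  rcases hij.lt_or_gt with h | h
  · rw [det_sub_comm]; exact key i j h
  · exact key j i h

lemma ne_zero_of_normalTuple_mem {μ ν : ℝ} {N : Matrix (Fin 2) (Fin 2) ℝ}
    (h : normalTuple μ ν N ∈ separatedMatrices 4) :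
    1 - μ ≠ 0 ∧ N.det ≠ 0 ∧ (N - 1).det ≠ 0 ∧ (N - !![μ, 0; 0, ν]).det ≠ 0 := by
  have h12 := h 1 2 (by decide)
  have h30 := h 3 0 (by decide)
  have h31 := h 3 1 (by decide)
  have h32 := h 3 2 (by decide)
  refine ⟨fun h0 => h12 ?_, by simpa [normalTuple] using h30, by simpa [normalTuple] using h31,
    by simpa [normalTuple] using h32⟩
  simp [normalTuple, Matrix.det_fin_two, h0]

lemma exists_joinedIn_upper_one {μ ν : ℝ} (hμ : 0 < μ) (hν : ν < 0)
    {N : Matrix (Fin 2) (Fin 2) ℝ} (hN : N 0 1 = 0 ∨ N 0 1 = 1)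
    (h : normalTuple μ ν N ∈ separatedMatrices 4) :
    ∃ N', N' 0 1 = 1 ∧ N'.det = N.det ∧ (N' - 1).det = (N - 1).det ∧
      (N' - !![μ, 0; 0, ν]).det = (N - !![μ, 0; 0, ν]).det ∧
      JoinedIn (separatedMatrices 4) (normalTuple μ ν N) (normalTuple μ ν N') := by
  obtain ⟨p, q, r, s, rfl⟩ : ∃ a b c d : ℝ, N = !![a, b; c, d] := ⟨_, _, _, _, N.eta_fin_two⟩
  obtain ⟨h1, h2, h3, h4⟩ := ne_zero_of_normalTuple_mem h
  rcases hN with hq | hq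
  · simp at hq
    subst hq
    simp [Matrix.det_fin_two] at h2 h3 h4
    refine ⟨!![p, 1; 0, s], by simp, ?_, ?_, ?_, ?_⟩
    · simp [Matrix.det_fin_two]
    · simp [Matrix.det_fin_two]
    · simp [Matrix.det_fin_two]
    · refine JoinedIn.trans (y := normalTuple μ ν !![p, 0; 0, s])
        (JoinedIn.ofLine (f := fun t => normalTuple μ ν !![p, 0; (1 - t) * r, s]) ?_ ?_ ?_ ?_)
        (JoinedIn.ofLine (f := fun t => normalTuple μ ν !![p, t; 0, s]) ?_ ?_ ?_ ?_)
      · simp only [normalTuple]; fun_prop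
      · simp
      · simp
      · rintro _ ⟨t, -, rfl⟩
        apply normalTuple_mem hμ hν h1 <;> simpa [Matrix.det_fin_two]
      · simp only [normalTuple]; fun_prop
      · simp
      · simp
      · rintro _ ⟨t, -, rfl⟩
        apply normalTuple_mem hμ hν h1 <;> simpa [Matrix.det_fin_two]
  · exact ⟨_, hq, rfl, rfl, rfl, JoinedIn.refl h⟩

/-- The matrix `N` with upper right entry one and prescribed determinants of `N`, `N - 1` and
`N - diag(μ, ν)`. -/
noncomputable def matrixOfDets (μ ν x y z : ℝ) : Matrix (Fin 2) (Fin 2) ℝ :=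
  !![(μ * (1 + x - y) - (μ * ν + x - z)) / (μ - ν), 1;
    (μ * (1 + x - y) - (μ * ν + x - z)) / (μ - ν) *
      ((μ * ν + x - z - ν * (1 + x - y)) / (μ - ν)) - x,
    (μ * ν + x - z - ν * (1 + x - y)) / (μ - ν)]

lemma det_matrixOfDets (μ ν x y z : ℝ) : (matrixOfDets μ ν x y z).det = x := by
  simp [matrixOfDets, Matrix.det_fin_two]

lemma det_matrixOfDets_sub_one {μ ν : ℝ} (h : μ - ν ≠ 0) (x y z : ℝ) :
    (matrixOfDets μ ν x y z - 1).det = y := by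
  simp [matrixOfDets, Matrix.det_fin_two]
  field_simp
  ring

lemma det_matrixOfDets_sub_diagonal {μ ν : ℝ} (h : μ - ν ≠ 0) (x y z : ℝ) :
    (matrixOfDets μ ν x y z - !![μ, 0; 0, ν]).det = z := by
  simp [matrixOfDets, Matrix.det_fin_two]
  field_simp
  ring

lemma eq_matrixOfDets {μ ν : ℝ} (h : μ - ν ≠ 0) {N : Matrix (Fin 2) (Fin 2) ℝ}
    (hN : N 0 1 = 1) :
    N = matrixOfDets μ ν N.det (N - 1).det (N - !![μ, 0; 0, ν]).det := by
  obtain ⟨p, q, r, s, rfl⟩ : ∃ a b c d : ℝ, N = !![a, b; c, d] := ⟨_, _, _, _, N.eta_fin_two⟩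
  simp at hN
  subst hN
  ext i j
  fin_cases i <;> fin_cases j <;> simp [matrixOfDets, Matrix.det_fin_two] <;> field_simp <;> ring

lemma segment_pos {a b : ℝ} (ha : 0 < a) (hb : 0 < b) {t : ℝ} (ht : t ∈ Set.Icc (0 : ℝ) 1) :
    0 < (1 - t) * a + t * b :=
  convex_Ioi (0 : ℝ) ha hb (sub_nonneg.2 ht.2) ht.1 (sub_add_cancel 1 t)

lemma segment_ne_zero {a b : ℝ} (h : 0 < a * b) {t : ℝ} (ht : t ∈ Set.Icc (0 : ℝ) 1) :
    (1 - t) * a + t * b ≠ 0 := by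
  rcases pos_and_pos_or_neg_and_neg_of_mul_pos h with ⟨ha, hb⟩ | ⟨ha, hb⟩
  · exact (segment_pos ha hb ht).ne'
  · have := segment_pos (neg_pos.2 ha) (neg_pos.2 hb) ht
    linarith

lemma joinedIn_normalTuple_of_upper_one {μ ν μ' ν' : ℝ} (hμ : 0 < μ) (hν : ν < 0)
    (hμ' : 0 < μ') (hν' : ν' < 0) {N N' : Matrix (Fin 2) (Fin 2) ℝ} (hN : N 0 1 = 1)
    (hN' : N' 0 1 = 1) (h1 : 0 < (1 - μ) * (1 - μ')) (hx : 0 < N.det * N'.det)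
    (hy : 0 < (N - 1).det * (N' - 1).det)
    (hz : 0 < (N - !![μ, 0; 0, ν]).det * (N' - !![μ', 0; 0, ν']).det) :
    JoinedIn (separatedMatrices 4) (normalTuple μ ν N) (normalTuple μ' ν' N') := by
  have hsub : μ - ν ≠ 0 := by linarith
  have hsub' : μ' - ν' ≠ 0 := by linarith
  rw [eq_matrixOfDets hsub hN, eq_matrixOfDets hsub' hN']
  generalize N.det = x, N'.det = x', (N - 1).det = y, (N' - 1).det = y',
    (N - !![μ, 0; 0, ν]).det = z, (N' - !![μ', 0; 0, ν']).det = z' at *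
  have hμt : ∀ t ∈ Set.Icc (0 : ℝ) 1, 0 < (1 - t) * μ + t * μ' := fun t ht =>
    segment_pos hμ hμ' ht
  have hνt : ∀ t ∈ Set.Icc (0 : ℝ) 1, (1 - t) * ν + t * ν' < 0 := fun t ht => by
    linarith [segment_pos (neg_pos.2 hν) (neg_pos.2 hν') ht]
  have hne : ∀ t ∈ Set.Icc (0 : ℝ) 1,
      (1 - t) * μ + t * μ' - ((1 - t) * ν + t * ν') ≠ 0 := fun t ht => by
    linarith [hμt t ht, hνt t ht]
  refine JoinedIn.ofLine (f := fun t => normalTuple ((1 - t) * μ + t * μ')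
    ((1 - t) * ν + t * ν') (matrixOfDets ((1 - t) * μ + t * μ') ((1 - t) * ν + t * ν')
      ((1 - t) * x + t * x') ((1 - t) * y + t * y') ((1 - t) * z + t * z'))) ?_ ?_ ?_ ?_
  · simp only [normalTuple, matrixOfDets]
    fun_prop (disch := assumption)
  · simp
  · simp
  · rintro _ ⟨t, ht, rfl⟩
    refine normalTuple_mem (hμt t ht) (hνt t ht) ?_ ?_ ?_ ?_
    · convert segment_ne_zero h1 ht using 1; ring
    · rw [det_matrixOfDets]; exact segment_ne_zero hx ht
    · rw [det_matrixOfDets_sub_one (hne t ht)]; exact segment_ne_zero hy ht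
    · rw [det_matrixOfDets_sub_diagonal (hne t ht)]; exact segment_ne_zero hz ht

lemma joinedIn_normalTuple {μ ν μ' ν' : ℝ} (hμ : 0 < μ) (hν : ν < 0) (hμ' : 0 < μ')
    (hν' : ν' < 0) {N N' : Matrix (Fin 2) (Fin 2) ℝ} (hN : N 0 1 = 0 ∨ N 0 1 = 1)
    (hN' : N' 0 1 = 0 ∨ N' 0 1 = 1)
    (h : ∀ i j, i ≠ j → 0 < (normalTuple μ ν N i - normalTuple μ ν N j).det *
      (normalTuple μ' ν' N' i - normalTuple μ' ν' N' j).det) :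
    JoinedIn (separatedMatrices 4) (normalTuple μ ν N) (normalTuple μ' ν' N') := by
  obtain ⟨K, hK, e0, e1, e2, hj⟩ := exists_joinedIn_upper_one hμ hν hN
    fun i j hij => left_ne_zero_of_mul (h i j hij).ne'
  obtain ⟨K', hK', e0', e1', e2', hj'⟩ := exists_joinedIn_upper_one hμ' hν' hN'
    fun i j hij => right_ne_zero_of_mul (h i j hij).ne'
  refine (hj.trans (joinedIn_normalTuple_of_upper_one hμ hν hμ' hν' hK hK' ?_ ?_ ?_ ?_)).trans
    hj'.symm
  · have := h 1 2 (by decide)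
    simp [normalTuple, Matrix.det_fin_two] at this
    have hp : 0 < (1 - ν) * (1 - ν') := mul_pos (by linarith) (by linarith)
    exact pos_of_mul_pos_left (by linarith) hp.le
  · have := h 3 0 (by decide)
    rw [e0, e0']
    simpa [normalTuple] using this
  · rw [e1, e1']
    exact h 3 1 (by decide)
  · rw [e2, e2']
    exact h 3 2 (by decide)

lemma HasGraphForm.exists_normalTuple {L : Fin 5 → PLine} {A : Matrix (Fin 4) (Fin 4) ℝ}
    {M : Fin 4 → Matrix (Fin 2) (Fin 2) ℝ} (h : HasGraphForm L A M) (hA : 0 < A.det)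
    (h0 : M 0 = 0) (h1 : M 1 = 1) (h2 : (M 2).det < 0) :
    ∃ A' μ ν N, HasGraphForm L A' (normalTuple μ ν N) ∧ 0 < A'.det ∧ 0 < μ ∧ ν < 0 ∧
      (N 0 1 = 0 ∨ N 0 1 = 1) := by
  obtain ⟨S, μ, ν, hS, hμ, hν, hSM⟩ := exists_mul_eq_mul_diagonal h2
  have hSu : IsUnit S.det := isUnit_iff_ne_zero.2 hS
  have hconj : HasGraphForm L (A * doubleMatrix S) (normalTuple μ ν (S⁻¹ * M 3 * S)) := by
    refine h.conj hS fun i => ?_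
    fin_cases i
    · simp [normalTuple, h0]
    · simp [normalTuple, h1]
    · exact hSM
    · simp [normalTuple, ← mul_assoc, Matrix.mul_nonsing_inv _ hSu]
  have hA' : 0 < (A * doubleMatrix S).det := by
    rw [Matrix.det_mul, det_doubleMatrix]; positivity
  obtain ⟨p, q, r, s, hN⟩ : ∃ a b c d : ℝ, S⁻¹ * M 3 * S = !![a, b; c, d] :=
    ⟨_, _, _, _, Matrix.eta_fin_two _⟩
  rw [hN] at hconj
  by_cases hq : q = 0
  · exact ⟨_, μ, ν, _, hconj, hA', hμ, hν, .inl (by simpa using hq)⟩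
  · have hT : (!![1, 0; 0, q⁻¹] : Matrix (Fin 2) (Fin 2) ℝ).det ≠ 0 := by
      simpa [Matrix.det_fin_two] using hq
    refine ⟨_, μ, ν, !![p, 1; q * r, s], hconj.conj hT fun i => ?_, ?_, hμ, hν, .inr (by simp)⟩
    · fin_cases i
      · simp [normalTuple]
      · simp [normalTuple]
      · simp [normalTuple, mul_comm]
      · simp [normalTuple, mul_comm, hq]
    · rw [Matrix.det_mul, det_doubleMatrix]; positivity

lemma mul_pos_of_sign_eq {a b : ℝ} (ha : a ≠ 0) (h : Real.sign a = Real.sign b) : 0 < a * b := by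
  rcases lt_or_gt_of_ne ha with ha | ha
  · rw [Real.sign_of_neg ha] at h
    rcases lt_trichotomy b 0 with hb | hb | hb
    · exact mul_pos_of_neg_of_neg ha hb
    · rw [hb, Real.sign_zero] at h; norm_num at h
    · rw [Real.sign_of_pos hb] at h; norm_num at h
  · rw [Real.sign_of_pos ha] at h
    rcases lt_trichotomy b 0 with hb | hb | hb
    · rw [Real.sign_of_neg hb] at h; norm_num at h
    · rw [hb, Real.sign_zero] at h; norm_num at h
    · exact mul_pos ha hb

lemma pos_of_sign_eq_one {a : ℝ} (h : Real.sign a = 1) : 0 < a := by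
  have := mul_pos_of_sign_eq one_ne_zero (b := a) (by rw [h, Real.sign_one])
  linarith

lemma neg_of_sign_eq_neg_one {a : ℝ} (h : Real.sign a = -1) : a < 0 := by
  have := mul_pos_of_sign_eq (a := -1) (by norm_num) (b := a)
    (by rw [h, Real.sign_of_neg (by norm_num)])
  linarith

lemma PairwiseSkew.exists_normalTuple {L : Fin 5 → PLine} (hL : PairwiseSkew L)
    (h1 : lk (L 0) (L 1) (L 2) = 1) (h2 : lk (L 0) (L 1) (L 3) = -1) :
    ∃ A μ ν N, HasGraphForm L A (normalTuple μ ν N) ∧ 0 < A.det ∧ 0 < μ ∧ ν < 0 ∧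
      (N 0 1 = 0 ∨ N 0 1 = 1) := by
  obtain ⟨A, M, hM, hM0, hM1⟩ := hL.exists_hasGraphForm
  have e1 := hM.lk_zero 0 1
  have e2 := hM.lk_zero 0 2
  rw [hM0, det_sub_comm, sub_zero] at e1 e2
  rw [hM1, Matrix.det_one, mul_one] at e1
  have hA : 0 < A.det := pos_of_sign_eq_one (e1.symm.trans h1)
  have hlt : A.det * (M 2).det < 0 := neg_of_sign_eq_neg_one (e2.symm.trans h2)
  exact hM.exists_normalTuple hA hM0 hM1 (neg_of_mul_neg_right hlt hA.le)

lemma deformation_of_lk_zero_eq {L L' : Fin 5 → PLine} (hL : PairwiseSkew L)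
    (hL' : PairwiseSkew L') (h1 : lk (L 0) (L 1) (L 2) = 1) (h2 : lk (L 0) (L 1) (L 3) = -1)
    (h : ∀ i j : Fin 4, i ≠ j → lk (L 0) (L i.succ) (L j.succ) =
      lk (L' 0) (L' i.succ) (L' j.succ)) : Deformation L L' := by
  obtain ⟨A, μ, ν, N, hM, hA, hμ, hν, hN⟩ := hL.exists_normalTuple h1 h2
  obtain ⟨A', μ', ν', N', hM', hA', hμ', hν', hN'⟩ := hL'.exists_normalTuple
    ((h 0 1 (by decide)).symm.trans h1) ((h 0 2 (by decide)).symm.trans h2)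
  refine hM.deformation hM' hA hA' (joinedIn_normalTuple hμ hν hμ' hν' hN hN' fun i j hij => ?_)
  have hs := h i j hij
  rw [hM.lk_zero, hM'.lk_zero] at hs
  have := mul_pos_of_sign_eq (mul_ne_zero hA.ne' (hM.mem_separatedMatrices hL i j hij)) hs
  rw [mul_mul_mul_comm] at this
  exact pos_of_mul_pos_right this (mul_pos hA hA').le

/-- The matrix of multiplication by `x + iy` on the complex plane. -/
def conformalMatrix (x y : ℝ) : Matrix (Fin 2) (Fin 2) ℝ := !![x, -y; y, x]

lemma det_conformalMatrix_sub (x y x' y' : ℝ) :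
    (conformalMatrix x y - conformalMatrix x' y').det = (x - x') ^ 2 + (y - y') ^ 2 := by
  simp [conformalMatrix, Matrix.det_fin_two]; ring

lemma exists_joinedIn_conformalMatrix {n : ℕ} {M : Fin n → Matrix (Fin 2) (Fin 2) ℝ}
    (hM : ∀ i j, i ≠ j → 0 < (M i - M j).det) :
    ∃ x y : Fin n → ℝ,
      JoinedIn (separatedMatrices n) M fun i => conformalMatrix (x i) (y i) := by
  refine ⟨fun i => (M i 0 0 + M i 1 1) / 2, fun i => (M i 1 0 - M i 0 1) / 2,
    JoinedIn.ofLine (f := fun t i => conformalMatrix ((M i 0 0 + M i 1 1) / 2)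
      ((M i 1 0 - M i 0 1) / 2) + (1 - t) • !![(M i 0 0 - M i 1 1) / 2, (M i 1 0 + M i 0 1) / 2;
        (M i 1 0 + M i 0 1) / 2, (M i 1 1 - M i 0 0) / 2]) ?_ ?_ ?_ ?_⟩
  · fun_prop
  · ext i a b
    fin_cases a <;> fin_cases b <;> simp [conformalMatrix] <;> ring
  · simp
  · rintro _ ⟨t, ⟨h0, h1⟩, rfl⟩ i j hij
    have := hM i j hij
    simp [conformalMatrix, Matrix.det_fin_two] at this ⊢
    have ht : (1 - t) ^ 2 ≤ 1 := by nlinarith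
    have hp := mul_le_mul_of_nonneg_right ht
      (by positivity : 0 ≤ (M i 0 0 - M i 1 1 - (M j 0 0 - M j 1 1)) ^ 2 +
        (M i 1 0 + M i 0 1 - (M j 1 0 + M j 0 1)) ^ 2)
    apply ne_of_gt
    linarith

lemma exists_injective_add_mul {n : ℕ} {x y : Fin n → ℝ}
    (h : ∀ i j, i ≠ j → (x i - x j) ^ 2 + (y i - y j) ^ 2 ≠ 0) :
    ∃ s : ℝ, Function.Injective fun i => x i + s * y i := by
  have hfin : (⋃ (i : Fin n) (j : Fin n) (_ : i ≠ j),
      {s : ℝ | x i + s * y i = x j + s * y j}).Finite := by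
    refine Set.finite_iUnion fun i => Set.finite_iUnion fun j => Set.finite_iUnion fun hij =>
      Set.Subsingleton.finite fun s hs t ht => ?_
    simp only [Set.mem_ofPred_eq] at hs ht
    by_contra hst
    have hy : y i - y j = 0 := by
      refine (mul_eq_zero.1 (?_ : (s - t) * (y i - y j) = 0)).resolve_left (sub_ne_zero.2 hst)
      linear_combination hs - ht
    refine h i j hij ?_
    have hx : x i - x j = 0 := by linear_combination hs - s * hy
    rw [hx, hy]; ring
  obtain ⟨s, hs⟩ := hfin.infinite_compl.nonempty
  refine ⟨s, fun i j hij => ?_⟩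
  by_contra hne
  exact hs (Set.mem_iUnion.2 ⟨i, Set.mem_iUnion.2 ⟨j, Set.mem_iUnion.2 ⟨hne, hij⟩⟩⟩)

lemma exists_joinedIn_smul_one {n : ℕ} {M : Fin n → Matrix (Fin 2) (Fin 2) ℝ}
    (hM : ∀ i j, i ≠ j → 0 < (M i - M j).det) :
    ∃ f : Fin n → ℝ, Function.Injective f ∧
      JoinedIn (separatedMatrices n) M fun i => conformalMatrix (f i) 0 := by
  obtain ⟨x, y, hxy⟩ := exists_joinedIn_conformalMatrix hM
  have hne : ∀ i j, i ≠ j → (x i - x j) ^ 2 + (y i - y j) ^ 2 ≠ 0 := fun i j hij => by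
    rw [← det_conformalMatrix_sub]; exact hxy.mem.2 i j hij
  obtain ⟨s, hs⟩ := exists_injective_add_mul hne
  refine ⟨_, hs, hxy.trans (JoinedIn.trans (y := fun i => conformalMatrix (x i + s * y i) (y i))
    (JoinedIn.ofLine (f := fun t i => conformalMatrix (x i + (t * s) * y i) (y i)) ?_ ?_ ?_ ?_)
    (JoinedIn.ofLine (f := fun t i => conformalMatrix (x i + s * y i) ((1 - t) * y i))
      ?_ ?_ ?_ ?_))⟩
  · simp only [conformalMatrix]; fun_prop
  · simp
  · simp
  · rintro _ ⟨t, -, rfl⟩ i j hij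
    rw [det_conformalMatrix_sub]
    intro h0
    have hy : y i - y j = 0 := by nlinarith
    refine hne i j hij ?_
    rw [← h0]
    linear_combination (-2 * (x i - x j) - t * s * (y i - y j)) * (t * s) * hy
  · simp only [conformalMatrix]; fun_prop
  · simp
  · simp
  · rintro _ ⟨t, -, rfl⟩ i j hij
    rw [det_conformalMatrix_sub]
    have : x i + s * y i - (x j + s * y j) ≠ 0 := sub_ne_zero.2 (hs.ne hij)
    positivity

lemma joinedIn_of_strictMono {n : ℕ} {f g : Fin n → ℝ} (hf : StrictMono f) (hg : StrictMono g) :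
    JoinedIn (separatedMatrices n) (fun i => conformalMatrix (f i) 0)
      fun i => conformalMatrix (g i) 0 := by
  refine JoinedIn.ofLine (f := fun t i => conformalMatrix ((1 - t) * f i + t * g i) 0) ?_ ?_ ?_ ?_
  · simp only [conformalMatrix]; fun_prop
  · simp
  · simp
  · rintro _ ⟨t, ht, rfl⟩ i j hij
    have key : ∀ i j, i < j → 0 < (1 - t) * f j + t * g j - ((1 - t) * f i + t * g i) := by
      intro i j hij
      linarith [segment_pos (sub_pos.2 (hf hij)) (sub_pos.2 (hg hij)) ht]
    rw [det_conformalMatrix_sub, sub_self, zero_pow two_ne_zero, add_zero]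
    refine pow_ne_zero 2 ?_
    rcases hij.lt_or_gt with h | h
    · linarith [key i j h]
    · linarith [key j i h]

lemma JoinedIn.comp_perm {n : ℕ} {M N : Fin n → Matrix (Fin 2) (Fin 2) ℝ}
    (h : JoinedIn (separatedMatrices n) M N) (σ : Equiv.Perm (Fin n)) :
    JoinedIn (separatedMatrices n) (M ∘ σ) (N ∘ σ) := by
  refine (h.map (f := fun M : Fin n → Matrix (Fin 2) (Fin 2) ℝ => M ∘ σ) (by fun_prop)).mono ?_
  rintro _ ⟨B, hB, rfl⟩ i j hij
  exact hB _ _ (σ.injective.ne hij)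

lemma HasGraphForm.comp_perm {n : ℕ} {L : Fin (n + 1) → PLine} {A : Matrix (Fin 4) (Fin 4) ℝ}
    {M : Fin n → Matrix (Fin 2) (Fin 2) ℝ} (h : HasGraphForm L A M) (σ : Equiv.Perm (Fin n)) :
    HasGraphForm (L ∘ Equiv.Perm.decomposeFin.symm (0, σ)) A (M ∘ σ) := by
  refine ⟨h.1, fun i => ?_⟩
  refine Fin.cases ?_ (fun i => ?_) i
  · simp [h.2, graphConfig]
  · simp [h.2, graphConfig]

lemma PairwiseSkew.exists_perm_of_lk_eq_one {L : Fin 5 → PLine} (hL : PairwiseSkew L)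
    (h : ∀ i j k, i ≠ j → i ≠ k → j ≠ k → lk (L i) (L j) (L k) = 1) :
    ∃ (π : Equiv.Perm (Fin 5)) (A : Matrix (Fin 4) (Fin 4) ℝ)
      (M : Fin 4 → Matrix (Fin 2) (Fin 2) ℝ), HasGraphForm (L ∘ π) A M ∧ 0 < A.det ∧
      JoinedIn (separatedMatrices 4) M fun i => conformalMatrix (i : ℕ) 0 := by
  obtain ⟨A, M, hM, hM0, hM1⟩ := hL.exists_hasGraphForm
  have hlk : ∀ i j : Fin 4, i ≠ j → 0 < A.det * (M i - M j).det := fun i j hij =>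
    pos_of_sign_eq_one ((hM.lk_zero i j).symm.trans (h _ _ _ (Fin.succ_ne_zero i).symm
      (Fin.succ_ne_zero j).symm ((Fin.succ_injective _).ne hij)))
  have hA : 0 < A.det := by
    have := hlk 1 0 (by decide)
    rwa [hM0, hM1, sub_zero, Matrix.det_one, mul_one] at this
  obtain ⟨f, hf, hj⟩ := exists_joinedIn_smul_one fun i j hij =>
    pos_of_mul_pos_right (hlk i j hij) hA.le
  refine ⟨_, A, _, hM.comp_perm (Tuple.sort f), hA, (hj.comp_perm _).trans
    (joinedIn_of_strictMono (f := f ∘ Tuple.sort f)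
      ((Tuple.monotone_sort f).strictMono_of_injective (hf.comp (Tuple.sort f).injective))
      fun i j hij => by exact_mod_cast hij)⟩

lemma deformEquiv_of_lk_eq_one {L L' : Fin 5 → PLine} (hL : PairwiseSkew L)
    (hL' : PairwiseSkew L')
    (h : ∀ i j k, i ≠ j → i ≠ k → j ≠ k → lk (L i) (L j) (L k) = 1)
    (h' : ∀ i j k, i ≠ j → i ≠ k → j ≠ k → lk (L' i) (L' j) (L' k) = 1) :
    DeformEquiv L L' := by
  obtain ⟨π, A, M, hM, hA, hj⟩ := hL.exists_perm_of_lk_eq_one h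
  obtain ⟨π', A', M', hM', hA', hj'⟩ := hL'.exists_perm_of_lk_eq_one h'
  exact ⟨π, π', hM.deformation hM' hA hA' (hj.trans hj'.symm)⟩

/-- The reflection in the first coordinate. -/
noncomputable def mirrorMatrix : Matrix (Fin 4) (Fin 4) ℝ := Matrix.diagonal ![-1, 1, 1, 1]

/-- The mirror image of a line under the reflection in the first coordinate. -/
noncomputable def mirrorLine (P : PLine) : PLine := P.map mirrorMatrix.mulVecLin

lemma det_mirrorMatrix : mirrorMatrix.det = -1 := by
  simp [mirrorMatrix, Fin.prod_univ_four]

lemma mirrorLine_mirrorLine (P : PLine) : mirrorLine (mirrorLine P) = P := by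
  have : mirrorMatrix * mirrorMatrix = 1 := by
    rw [mirrorMatrix, Matrix.diagonal_mul_diagonal, ← Matrix.diagonal_one]
    congr 1
    ext i
    fin_cases i <;> simp
  rw [mirrorLine, mirrorLine, ← Submodule.map_comp, ← Matrix.mulVecLin_mul, this,
    Matrix.mulVecLin_one, Submodule.map_id]

lemma mirrorLine_lineOf (P : Fin 2 → V4) :
    mirrorLine (lineOf P) = lineOf fun k => mirrorMatrix *ᵥ P k :=
  (lineOf_mulVec _ _).symm

lemma isMirror_mirrorLine {n : ℕ} (L : Fin n → PLine) : IsMirror L (mirrorLine ∘ L) := by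
  refine ⟨mirrorMatrix.mulVecLin, ?_, fun _ => rfl⟩
  rw [← Matrix.toLin'_apply', LinearMap.det_toLin', det_mirrorMatrix]
  norm_num

lemma lk_map {P Q R : PLine} (hP : IsLine P) (hQ : IsLine Q) (hR : IsLine R)
    {f : V4 →ₗ[ℝ] V4} (hf : LinearMap.det f < 0) :
    lk (P.map f) (Q.map f) (R.map f) = -lk P Q R := by
  obtain ⟨X, rfl⟩ := hP.exists_lineOf
  obtain ⟨Y, rfl⟩ := hQ.exists_lineOf
  obtain ⟨Z, rfl⟩ := hR.exists_lineOf
  obtain ⟨A, rfl⟩ : ∃ A : Matrix (Fin 4) (Fin 4) ℝ, f = A.mulVecLin :=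
    ⟨LinearMap.toMatrix' f, by rw [← Matrix.toLin'_apply', Matrix.toLin'_toMatrix']⟩
  rw [← Matrix.toLin'_apply', LinearMap.det_toLin'] at hf
  rw [← lineOf_mulVec, ← lineOf_mulVec, ← lineOf_mulVec, lk_lineOf, lk_lineOf, pdet_mulVec,
    pdet_mulVec, pdet_mulVec, ← Real.sign_neg]
  generalize pdet X Y = a, pdet X Z = b, pdet Y Z = c
  rw [show A.det * a * (A.det * b) * (A.det * c) = A.det ^ 3 * (a * b * c) by ring]
  have hA : A.det ^ 3 < 0 := Odd.pow_neg (by decide) hf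
  rcases lt_trichotomy (a * b * c) 0 with h | h | h
  · rw [Real.sign_of_pos (mul_pos_of_neg_of_neg hA h), Real.sign_of_pos (neg_pos.2 h)]
  · rw [h, mul_zero, neg_zero]
  · rw [Real.sign_of_neg (mul_neg_of_neg_of_pos hA h), Real.sign_of_neg (neg_neg_of_pos h)]

lemma lk_mirrorLine {P Q R : PLine} (hP : IsLine P) (hQ : IsLine Q) (hR : IsLine R) :
    lk (mirrorLine P) (mirrorLine Q) (mirrorLine R) = -lk P Q R :=
  lk_map hP hQ hR <| by
    rw [← Matrix.toLin'_apply', LinearMap.det_toLin', det_mirrorMatrix]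
    norm_num

lemma Skew.mirrorLine {P Q : PLine} (h : Skew P Q) : Skew (mirrorLine P) (mirrorLine Q) := by
  obtain ⟨X, rfl⟩ := h.1.exists_lineOf
  obtain ⟨Y, rfl⟩ := h.2.1.exists_lineOf
  rw [mirrorLine_lineOf, mirrorLine_lineOf]
  refine skew_of_pdet_ne_zero ?_
  rw [pdet_mulVec, det_mirrorMatrix]
  simpa using pdet_ne_zero_of_skew h

lemma PairwiseSkew.mirrorLine {n : ℕ} {L : Fin n → PLine} (h : PairwiseSkew L) :
    PairwiseSkew (mirrorLine ∘ L) := fun i j hij => (h i j hij).mirrorLine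

lemma PairwiseSkew.comp {m n : ℕ} {L : Fin n → PLine} (h : PairwiseSkew L) {f : Fin m → Fin n}
    (hf : Function.Injective f) : PairwiseSkew (L ∘ f) := fun _ _ hij => h _ _ (hf.ne hij)

lemma PairwiseSkew.isLine {n : ℕ} {L : Fin (n + 2) → PLine} (h : PairwiseSkew L)
    (i : Fin (n + 2)) : IsLine (L i) := by
  obtain ⟨j, hj⟩ := exists_ne i
  exact (h i j hj.symm).1

lemma Deformation.mirrorLine {n : ℕ} {L L' : Fin n → PLine} (h : Deformation L L') :
    Deformation (mirrorLine ∘ L) (mirrorLine ∘ L') := by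
  obtain ⟨F, hF, hs, rfl, rfl⟩ := h
  refine ⟨fun t => _root_.mirrorLine ∘ F t, fun i => ?_, fun t ht => (hs t ht).mirrorLine, rfl,
    rfl⟩
  obtain ⟨v, w, hv, hw, h⟩ := hF i
  have hc : Continuous fun x : V4 => mirrorMatrix *ᵥ x := by fun_prop
  refine ⟨fun t => mirrorMatrix *ᵥ v t, fun t => mirrorMatrix *ᵥ w t, hc.comp_continuousOn hv,
    hc.comp_continuousOn hw, fun t ht => ?_⟩
  simp [_root_.mirrorLine, h t ht, Submodule.map_span, Set.image_pair]

lemma DeformEquiv.of_mirrorLine {n : ℕ} {L L' : Fin n → PLine}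
    (h : DeformEquiv (mirrorLine ∘ L) (mirrorLine ∘ L')) : DeformEquiv L L' := by
  obtain ⟨π, π', h⟩ := h
  refine ⟨π, π', ?_⟩
  have := h.mirrorLine
  simpa only [← Function.comp_assoc, Function.comp_def, mirrorLine_mirrorLine] using this

lemma DeformEquiv.of_comp {n : ℕ} {L L' : Fin n → PLine} {σ σ' : Equiv.Perm (Fin n)}
    (h : DeformEquiv (L ∘ σ) (L' ∘ σ')) : DeformEquiv L L' := by
  obtain ⟨π, π', h⟩ := h
  exact ⟨σ * π, σ' * π', h⟩

lemma deformEquiv_of_deformation {n : ℕ} {L L' : Fin n → PLine} (h : Deformation L L') :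
    DeformEquiv L L' := ⟨1, 1, h⟩

/-- The parity of the three entries of a table indexed by pairs from a triple. -/
def tripleParity {α : Type*} (s : α → α → Bool) (i j k : α) : Bool := s i j ^^ s i k ^^ s j k

/-- A symmetric table with vanishing diagonal. -/
def IsGraphTable {α : Type*} (s : α → α → Bool) : Prop :=
  (∀ i j, s i j = s j i) ∧ ∀ i, s i i = false

/-- The linking indices of the configuration are the triple parities of the table. -/
def HasLkTable {n : ℕ} (L : Fin n → PLine) (s : Fin n → Fin n → Bool) : Prop :=
  IsGraphTable s ∧ ∀ i j k, i ≠ j → i ≠ k → j ≠ k →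
    lk (L i) (L j) (L k) = if tripleParity s i j k then -1 else 1

lemma IsGraphTable.tripleParity_swap_left {α : Type*} {s : α → α → Bool} (hs : IsGraphTable s)
    (i j k : α) : tripleParity s j i k = tripleParity s i j k := by
  rw [tripleParity, tripleParity, hs.1 j i, Bool.xor_right_comm]

lemma IsGraphTable.tripleParity_swap_right {α : Type*} {s : α → α → Bool} (hs : IsGraphTable s)
    (i j k : α) : tripleParity s i k j = tripleParity s i j k := by
  rw [tripleParity, tripleParity, hs.1 k j, Bool.xor_comm (s i k)]

lemma IsGraphTable.comp {α β : Type*} {s : α → α → Bool} (hs : IsGraphTable s) (f : β → α) :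
    IsGraphTable fun i j => s (f i) (f j) := ⟨fun _ _ => hs.1 _ _, fun _ => hs.2 _⟩

lemma HasLkTable.comp {m n : ℕ} {L : Fin n → PLine} {s : Fin n → Fin n → Bool}
    (h : HasLkTable L s) {f : Fin m → Fin n} (hf : Function.Injective f) :
    HasLkTable (L ∘ f) fun i j => s (f i) (f j) :=
  ⟨h.1.comp f, fun _ _ _ hij hik hjk => h.2 _ _ _ (hf.ne hij) (hf.ne hik) (hf.ne hjk)⟩

lemma sign_mul_mul {a b c : ℝ} (ha : a ≠ 0) (hb : b ≠ 0) (hc : c ≠ 0) :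
    Real.sign (a * b * c) =
      if (decide (a < 0) ^^ decide (b < 0) ^^ decide (c < 0)) then -1 else 1 := by
  rcases lt_or_gt_of_ne ha with ha | ha <;> rcases lt_or_gt_of_ne hb with hb | hb <;>
    rcases lt_or_gt_of_ne hc with hc | hc <;>
    simp only [ha, hb, hc, ha.le, hb.le, hc.le, not_lt.2, decide_true, decide_false,
      Bool.xor_true, Bool.xor_false, Bool.not_true, Bool.not_false, if_true, if_false,
      Bool.false_eq_true]
  all_goals first
    | exact Real.sign_of_pos (by
        first
          | exact mul_pos (mul_pos ha hb) hc
          | exact mul_pos (mul_pos_of_neg_of_neg ha hb) hc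
          | exact mul_pos_of_neg_of_neg (mul_neg_of_pos_of_neg ha hb) hc
          | exact mul_pos_of_neg_of_neg (mul_neg_of_neg_of_pos ha hb) hc)
    | exact Real.sign_of_neg (by
        first
          | exact mul_neg_of_pos_of_neg (mul_pos ha hb) hc
          | exact mul_neg_of_pos_of_neg (mul_pos_of_neg_of_neg ha hb) hc
          | exact mul_neg_of_neg_of_pos (mul_neg_of_pos_of_neg ha hb) hc
          | exact mul_neg_of_neg_of_pos (mul_neg_of_neg_of_pos ha hb) hc)

lemma PairwiseSkew.exists_hasLkTable {n : ℕ} {L : Fin (n + 2) → PLine} (hL : PairwiseSkew L) :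
    ∃ s, HasLkTable L s := by
  obtain ⟨X, hX, rfl⟩ := hL.exists_frames
  refine ⟨fun i j => decide (pdet (X i) (X j) < 0), ⟨fun i j => ?_, fun i => ?_⟩,
    fun i j k hij hik hjk => ?_⟩
  · simp only [pdet_comm (X i)]
  · simp [pdet_self]
  · rw [lk_lineOf, sign_mul_mul (hX i j hij) (hX i k hik) (hX j k hjk)]
    rfl

/-- The table switched so that the row of zero vanishes. -/
def switchTable {n : ℕ} (s : Fin (n + 1) → Fin (n + 1) → Bool) (i j : Fin (n + 1)) : Bool :=
  s i j ^^ (s 0 i ^^ s 0 j)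

lemma IsGraphTable.switchTable {n : ℕ} {s : Fin (n + 1) → Fin (n + 1) → Bool}
    (hs : IsGraphTable s) : IsGraphTable (switchTable s) := by
  refine ⟨fun i j => ?_, fun i => ?_⟩
  · rw [_root_.switchTable, _root_.switchTable, hs.1 j i, Bool.xor_comm (s 0 i)]
  · rw [_root_.switchTable, hs.2, Bool.xor_self, Bool.xor_self]

lemma IsGraphTable.switchTable_zero {n : ℕ} {s : Fin (n + 1) → Fin (n + 1) → Bool}
    (hs : IsGraphTable s) (i : Fin (n + 1)) : _root_.switchTable s 0 i = false := by
  rw [_root_.switchTable, hs.2, Bool.false_xor, Bool.xor_self]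

lemma tripleParity_switchTable {n : ℕ} (s : Fin (n + 1) → Fin (n + 1) → Bool)
    (i j k : Fin (n + 1)) : tripleParity (switchTable s) i j k = tripleParity s i j k := by
  simp only [tripleParity, switchTable]
  generalize s i j = a, s i k = b, s j k = c, s 0 i = d, s 0 j = e, s 0 k = f
  revert a b c d e f
  decide

lemma HasLkTable.switchTable {n : ℕ} {L : Fin (n + 1) → PLine}
    {s : Fin (n + 1) → Fin (n + 1) → Bool} (h : HasLkTable L s) :
    HasLkTable L (switchTable s) :=
  ⟨h.1.switchTable, fun i j k => by rw [tripleParity_switchTable]; exact h.2 i j k⟩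

lemma deformEquiv_of_lk_eq {L L' : Fin 5 → PLine} (hL : PairwiseSkew L) (hL' : PairwiseSkew L')
    (h : ∀ i j k, i ≠ j → i ≠ k → j ≠ k → lk (L i) (L j) (L k) = lk (L' i) (L' j) (L' k))
    {s : Fin 5 → Fin 5 → Bool} (hs : HasLkTable L s)
    (hs0 : tripleParity s 0 1 2 ≠ tripleParity s 0 1 3 ∨
      ∃ ε, ∀ i j k, i ≠ j → i ≠ k → j ≠ k → tripleParity s i j k = ε) : DeformEquiv L L' := by
  have hneg : ∀ i j k, i ≠ j → i ≠ k → j ≠ k →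
      lk ((mirrorLine ∘ L) i) ((mirrorLine ∘ L) j) ((mirrorLine ∘ L) k) =
        if tripleParity s i j k then 1 else -1 := by
    intro i j k hij hik hjk
    simp only [Function.comp]
    rw [lk_mirrorLine (hL.isLine i) (hL.isLine j) (hL.isLine k), hs.2 i j k hij hik hjk]
    split_ifs <;> norm_num
  have hneg' : ∀ i j k, i ≠ j → i ≠ k → j ≠ k →
      lk ((mirrorLine ∘ L) i) ((mirrorLine ∘ L) j) ((mirrorLine ∘ L) k) =
      lk ((mirrorLine ∘ L') i) ((mirrorLine ∘ L') j) ((mirrorLine ∘ L') k) := by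
    intro i j k hij hik hjk
    simp only [Function.comp]
    rw [lk_mirrorLine (hL.isLine i) (hL.isLine j) (hL.isLine k),
      lk_mirrorLine (hL'.isLine i) (hL'.isLine j) (hL'.isLine k), h i j k hij hik hjk]
  have hne : ∀ i : Fin 4, (0 : Fin 5) ≠ i.succ := fun i => (Fin.succ_ne_zero i).symm
  rcases hs0 with hs0 | ⟨ε, hε⟩
  · cases h2 : tripleParity s 0 1 2
    · have h3 : tripleParity s 0 1 3 = true := by simpa [h2] using hs0
      refine deformEquiv_of_deformation (deformation_of_lk_zero_eq hL hL' ?_ ?_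
        fun i j hij => h _ _ _ (hne i) (hne j) ((Fin.succ_injective _).ne hij))
      · rw [hs.2 0 1 2 (by decide) (by decide) (by decide), h2]; simp
      · rw [hs.2 0 1 3 (by decide) (by decide) (by decide), h3]; simp
    · have h3 : tripleParity s 0 1 3 = false := by simpa [h2] using hs0
      refine DeformEquiv.of_mirrorLine (deformEquiv_of_deformation
        (deformation_of_lk_zero_eq hL.mirrorLine hL'.mirrorLine ?_ ?_
        fun i j hij => hneg' _ _ _ (hne i) (hne j) ((Fin.succ_injective _).ne hij)))
      · rw [hneg 0 1 2 (by decide) (by decide) (by decide), h2]; simp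
      · rw [hneg 0 1 3 (by decide) (by decide) (by decide), h3]; simp
  · cases ε
    · refine deformEquiv_of_lk_eq_one hL hL' (fun i j k hij hik hjk => ?_)
        fun i j k hij hik hjk => ?_
      · rw [hs.2 i j k hij hik hjk, hε i j k hij hik hjk]; simp
      · rw [← h i j k hij hik hjk, hs.2 i j k hij hik hjk, hε i j k hij hik hjk]; simp
    · refine DeformEquiv.of_mirrorLine (deformEquiv_of_lk_eq_one hL.mirrorLine hL'.mirrorLine
        (fun i j k hij hik hjk => ?_) fun i j k hij hik hjk => ?_)
      · rw [hneg i j k hij hik hjk, hε i j k hij hik hjk]; simp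
      · rw [← hneg' i j k hij hik hjk, hneg i j k hij hik hjk, hε i j k hij hik hjk]; simp

/-- The number of triples of odd parity. -/
def oddTriples (s : Fin 5 → Fin 5 → Bool) : ℕ :=
  (tripleParity s 0 1 2).toNat + (tripleParity s 0 1 3).toNat + (tripleParity s 0 1 4).toNat +
  (tripleParity s 0 2 3).toNat + (tripleParity s 0 2 4).toNat + (tripleParity s 0 3 4).toNat +
  (tripleParity s 1 2 3).toNat + (tripleParity s 1 2 4).toNat + (tripleParity s 1 3 4).toNat +
  (tripleParity s 2 3 4).toNat

/-- The number of odd triples times the number of even triples. -/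
def oddMulEven (s : Fin 5 → Fin 5 → Bool) : ℕ := oddTriples s * (10 - oddTriples s)

/-- The parity of the number of neighbours. -/
def rowParity (s : Fin 6 → Fin 6 → Bool) (i : Fin 6) : Bool :=
  s i 0 ^^ s i 1 ^^ s i 2 ^^ s i 3 ^^ s i 4 ^^ s i 5

lemma forall_fin_six {p : Fin 6 → Prop} :
    (∀ i, p i) ↔ p 0 ∧ p 1 ∧ p 2 ∧ p 3 ∧ p 4 ∧ p 5 := by
  simp [Fin.forall_fin_succ]

lemma rowParity_eq_false_iff {s : Fin 6 → Fin 6 → Bool} (hs : IsGraphTable s)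
    (h0 : ∀ i, s 0 i = false) :
    (∀ i, rowParity s i = false) ↔
    ∀ i : Fin 6, oddMulEven (fun j k => s (i.succAbove j) (i.succAbove k)) =
      oddMulEven (fun j k => s (Fin.succAbove 0 j) (Fin.succAbove 0 k)) := by
  have h1 : (1 : Fin 6).succAbove = ![0, 2, 3, 4, 5] := by decide
  have h2 : (2 : Fin 6).succAbove = ![0, 1, 3, 4, 5] := by decide
  have h3 : (3 : Fin 6).succAbove = ![0, 1, 2, 4, 5] := by decide
  have h4 : (4 : Fin 6).succAbove = ![0, 1, 2, 3, 5] := by decide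
  have h5 : (5 : Fin 6).succAbove = ![0, 1, 2, 3, 4] := by decide
  have h6 : (0 : Fin 6).succAbove = ![1, 2, 3, 4, 5] := by decide
  rw [forall_fin_six, forall_fin_six]
  simp only [oddMulEven, oddTriples, rowParity, tripleParity, h1, h2, h3, h4, h5, h6,
    Matrix.cons_val, h0, hs.1 _ 0, hs.2, hs.1 2 1, hs.1 3 1, hs.1 4 1, hs.1 5 1,
    hs.1 3 2, hs.1 4 2, hs.1 5 2, hs.1 4 3, hs.1 5 3, hs.1 5 4]
  generalize s 1 2 = a, s 1 3 = b, s 1 4 = c, s 1 5 = d, s 2 3 = e, s 2 4 = f, s 2 5 = g,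
    s 3 4 = h, s 3 5 = i, s 4 5 = j
  clear h0 hs s h1 h2 h3 h4 h5 h6
  revert a b c d e f g h i j
  decide +kernel

/-- A graph on five vertices with `m` as its value of `oddMulEven`. -/
def canonicalEdges (m : ℕ) : List (Fin 5 × Fin 5) :=
  if m = 0 then [] else if m = 21 then [(0, 3)] else if m = 24 then [(0, 3), (0, 4)]
  else [(0, 1), (1, 2), (2, 3), (3, 4), (4, 0)]

/-- The adjacency table of `canonicalEdges`. -/
def canonicalTable (m : ℕ) (i j : Fin 5) : Bool :=
  decide ((i, j) ∈ canonicalEdges m ∨ (j, i) ∈ canonicalEdges m)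

lemma exists_canonical (a b c d e f : Bool) :
    let s : Fin 5 → Fin 5 → Bool := ![![false, false, false, false, false],
      ![false, false, a, b, c], ![false, a, false, d, e], ![false, b, d, false, f],
      ![false, c, e, f, false]]
    ∃ m ∈ [0, 21, 24, 25], oddMulEven s = m ∧ ∃ ε, ∃ p q, p ≠ q ∧ ∃ r, p ≠ r ∧ q ≠ r ∧
      tripleParity s p q r = (ε ^^ tripleParity (canonicalTable m) 0 1 2) ∧
      ∃ u, p ≠ u ∧ q ≠ u ∧ r ≠ u ∧
      tripleParity s p q u = (ε ^^ tripleParity (canonicalTable m) 0 1 3) ∧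
      tripleParity s p r u = (ε ^^ tripleParity (canonicalTable m) 0 2 3) ∧
      tripleParity s q r u = (ε ^^ tripleParity (canonicalTable m) 1 2 3) ∧
      ∃ v, p ≠ v ∧ q ≠ v ∧ r ≠ v ∧ u ≠ v ∧
      tripleParity s p q v = (ε ^^ tripleParity (canonicalTable m) 0 1 4) ∧
      tripleParity s p r v = (ε ^^ tripleParity (canonicalTable m) 0 2 4) ∧
      tripleParity s q r v = (ε ^^ tripleParity (canonicalTable m) 1 2 4) ∧
      tripleParity s p u v = (ε ^^ tripleParity (canonicalTable m) 0 3 4) ∧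
      tripleParity s q u v = (ε ^^ tripleParity (canonicalTable m) 1 3 4) ∧
      tripleParity s r u v = (ε ^^ tripleParity (canonicalTable m) 2 3 4) := by
  revert a b c d e f
  decide +kernel

lemma oddMulEven_switchTable (s : Fin 5 → Fin 5 → Bool) :
    oddMulEven (switchTable s) = oddMulEven s := by
  simp only [oddMulEven, oddTriples, tripleParity_switchTable]

lemma isGraphTable_canonicalTable (m : ℕ) : IsGraphTable (canonicalTable m) := by
  refine ⟨fun i j => by simp only [canonicalTable, or_comm], fun i => ?_⟩
  rw [canonicalTable, canonicalEdges]
  split_ifs <;> revert i <;> decide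

/-- Symmetric functions of triples agree once they agree on increasing triples. -/
lemma forall_triple_of_lt {α : Type*} [LinearOrder α] {p : α → α → α → Prop}
    (hl : ∀ i j k, p i j k → p j i k) (hr : ∀ i j k, p i j k → p i k j)
    (h : ∀ i j k, i < j → j < k → p i j k) {i j k : α} (hij : i ≠ j) (hik : i ≠ k) (hjk : j ≠ k) :
    p i j k := by
  rcases hij.lt_or_gt with hij | hij <;> rcases hik.lt_or_gt with hik | hik <;>
    rcases hjk.lt_or_gt with hjk | hjk
  · exact h _ _ _ hij hjk
  · exact hr _ _ _ (h _ _ _ hik hjk)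
  · exact absurd (hij.trans hjk) hik.asymm
  · exact hr _ _ _ (hl _ _ _ (h _ _ _ hik hij))
  · exact hl _ _ _ (h _ _ _ hij hik)
  · exact absurd (hjk.trans hij) hik.asymm
  · exact hl _ _ _ (hr _ _ _ (h _ _ _ hjk hik))
  · exact hl _ _ _ (hr _ _ _ (hl _ _ _ (h _ _ _ hjk hij)))

lemma IsGraphTable.exists_perm_canonicalTable {s : Fin 5 → Fin 5 → Bool} (hs : IsGraphTable s) :
    ∃ (σ : Equiv.Perm (Fin 5)) (ε : Bool), ∀ i j k, i ≠ j → i ≠ k → j ≠ k →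
      tripleParity s (σ i) (σ j) (σ k) =
        (ε ^^ tripleParity (canonicalTable (oddMulEven s)) i j k) := by
  wlog h0 : ∀ i, s 0 i = false generalizing s
  · simpa only [oddMulEven_switchTable, tripleParity_switchTable] using
      this hs.switchTable hs.switchTable_zero
  have hst : s = ![![false, false, false, false, false],
      ![false, false, s 1 2, s 1 3, s 1 4], ![false, s 1 2, false, s 2 3, s 2 4],
      ![false, s 1 3, s 2 3, false, s 3 4], ![false, s 1 4, s 2 4, s 3 4, false]] := by
    ext i j
    fin_cases i <;> fin_cases j <;> simp [h0, hs.2, hs.1 _ 0, hs.1 2 1, hs.1 3 1, hs.1 4 1,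
      hs.1 3 2, hs.1 4 2, hs.1 4 3]
  have h := exists_canonical (s 1 2) (s 1 3) (s 1 4) (s 2 3) (s 2 4) (s 3 4)
  rw [← hst] at h
  obtain ⟨m, -, rfl, ε, p, q, hpq, r, hpr, hqr, h012, u, hpu, hqu, hru, h013, h023, h123, v, hpv,
    hqv, hrv, huv, h014, h024, h124, h034, h134, h234⟩ := h
  have hinj : Function.Injective ![p, q, r, u, v] := by
    intro i j
    fin_cases i <;> fin_cases j <;> simp [hpq, hpr, hqr, hpu, hqu, hru, hpv, hqv, hrv, huv,
      hpq.symm, hpr.symm, hqr.symm, hpu.symm, hqu.symm, hru.symm, hpv.symm, hqv.symm, hrv.symm,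
      huv.symm]
  refine ⟨Equiv.ofBijective _ (Finite.injective_iff_bijective.1 hinj), ε, fun i j k =>
    forall_triple_of_lt (p := fun i j k => tripleParity s (![p, q, r, u, v] i) (![p, q, r, u, v] j)
      (![p, q, r, u, v] k) = (ε ^^ tripleParity (canonicalTable (oddMulEven s)) i j k))
      (fun i j k h => ?_) (fun i j k h => ?_) fun i j k hij hjk => ?_⟩
  · rwa [hs.tripleParity_swap_left,
      (isGraphTable_canonicalTable _).tripleParity_swap_left]
  · rwa [hs.tripleParity_swap_right,
      (isGraphTable_canonicalTable _).tripleParity_swap_right]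
  · fin_cases i <;> fin_cases j <;> first | exact absurd hij (by decide) | fin_cases k <;>
      first | exact absurd hjk (by decide) | assumption

lemma sum_eq_oddTriples {s : Fin 5 → Fin 5 → Bool} (hs : IsGraphTable s) :
    (∑ i, ∑ j, ∑ k, if i ≠ j ∧ i ≠ k ∧ j ≠ k then
      (if tripleParity s i j k then -1 else 1 : ℝ) else 0) = 6 * (10 - 2 * oddTriples s) := by
  have h (b : Bool) : (if b then -1 else 1 : ℝ) = 1 - 2 * b.toNat := by cases b <;> norm_num
  have hl := hs.tripleParity_swap_left
  have hr := hs.tripleParity_swap_right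
  simp only [h, oddTriples, Fin.sum_univ_five, hl 0 1, hl 0 2, hl 0 3, hl 0 4, hl 1 2, hl 1 3,
    hl 1 4, hl 2 3, hl 2 4, hl 3 4, hr _ 0 1, hr _ 0 2, hr _ 0 3, hr _ 0 4, hr _ 1 2, hr _ 1 3,
    hr _ 1 4, hr _ 2 3, hr _ 2 4, hr _ 3 4]
  simp
  ring

/-- The sum of the linking indices over ordered triples of distinct lines. -/
noncomputable def linkingSum {n : ℕ} (L : Fin n → PLine) : ℝ :=
  ∑ i, ∑ j, ∑ k, if i ≠ j ∧ i ≠ k ∧ j ≠ k then lk (L i) (L j) (L k) else 0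

lemma HasLkTable.linkingSum_eq {L : Fin 5 → PLine} {s : Fin 5 → Fin 5 → Bool}
    (h : HasLkTable L s) : linkingSum L = 6 * (10 - 2 * oddTriples s) := by
  rw [← sum_eq_oddTriples h.1, linkingSum]
  refine Finset.sum_congr rfl fun i _ => Finset.sum_congr rfl fun j _ =>
    Finset.sum_congr rfl fun k _ => ?_
  split_ifs with hd ht
  · rw [h.2 i j k hd.1 hd.2.1 hd.2.2, if_pos ht]
  · rw [h.2 i j k hd.1 hd.2.1 hd.2.2, if_neg ht]
  · rfl

lemma linkingSum_comp {n : ℕ} (L : Fin n → PLine) (σ : Equiv.Perm (Fin n)) :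
    linkingSum (L ∘ σ) = linkingSum L := by
  rw [linkingSum, linkingSum, eq_comm, ← Equiv.sum_comp σ]
  refine Finset.sum_congr rfl fun i _ => ?_
  rw [← Equiv.sum_comp σ]
  refine Finset.sum_congr rfl fun j _ => ?_
  rw [← Equiv.sum_comp σ]
  simp only [σ.injective.ne_iff, Function.comp]

lemma Deformation.linkingSum_eq {n : ℕ} {L L' : Fin n → PLine} (h : Deformation L L') :
    linkingSum L = linkingSum L' := by
  refine Finset.sum_congr rfl fun i _ => Finset.sum_congr rfl fun j _ =>
    Finset.sum_congr rfl fun k _ => ?_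
  split_ifs with hd
  · exact lk_eq_of_deformation h hd.1 hd.2.1 hd.2.2
  · rfl

lemma DeformEquiv.linkingSum_eq {n : ℕ} {L L' : Fin n → PLine} (h : DeformEquiv L L') :
    linkingSum L = linkingSum L' := by
  obtain ⟨π, π', h⟩ := h
  rw [← linkingSum_comp L π, h.linkingSum_eq, linkingSum_comp]

lemma IsMirror.linkingSum_eq {n : ℕ} {L L' : Fin (n + 2) → PLine} (h : IsMirror L L')
    (hL : PairwiseSkew L) : linkingSum L' = -linkingSum L := by
  obtain ⟨f, hf, h⟩ := h
  simp only [linkingSum, ← Finset.sum_neg_distrib]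
  refine Finset.sum_congr rfl fun i _ => Finset.sum_congr rfl fun j _ =>
    Finset.sum_congr rfl fun k _ => ?_
  rw [h, h, h, lk_map (hL.isLine i) (hL.isLine j) (hL.isLine k) hf]
  split_ifs <;> simp

lemma CoarseDeformEquiv.oddMulEven_eq {L L' : Fin 5 → PLine} (hL' : PairwiseSkew L')
    {s s' : Fin 5 → Fin 5 → Bool} (hs : HasLkTable L s) (hs' : HasLkTable L' s')
    (h : CoarseDeformEquiv L L') : oddMulEven s = oddMulEven s' := by
  have key : linkingSum L = linkingSum L' ∨ linkingSum L = -linkingSum L' := by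
    rcases h with h | ⟨M, hM, h⟩
    · exact .inl h.linkingSum_eq
    · exact .inr (h.linkingSum_eq.trans (hM.linkingSum_eq hL'))
  rw [hs.linkingSum_eq, hs'.linkingSum_eq] at key
  have h : oddTriples s = oddTriples s' ∨ oddTriples s + oddTriples s' = 10 := by
    refine key.imp (fun h => ?_) fun h => ?_ <;> rify <;> linarith
  rw [oddMulEven, oddMulEven]
  rcases h with h | h
  · rw [h]
  · rw [show oddTriples s = 10 - oddTriples s' by omega, mul_comm]
    congr 1
    omega

lemma tripleParity_canonicalTable (m : ℕ) :
    tripleParity (canonicalTable m) 0 1 2 ≠ tripleParity (canonicalTable m) 0 1 3 ∨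
      ∀ i j k, tripleParity (canonicalTable m) i j k = false := by
  simp only [tripleParity, canonicalTable, canonicalEdges]
  split_ifs <;> decide

lemma coarseDeformEquiv_of_oddMulEven_eq {L L' : Fin 5 → PLine} (hL : PairwiseSkew L)
    (hL' : PairwiseSkew L') {s s' : Fin 5 → Fin 5 → Bool} (hs : HasLkTable L s)
    (hs' : HasLkTable L' s') (h : oddMulEven s = oddMulEven s') : CoarseDeformEquiv L L' := by
  obtain ⟨σ, ε, hσ⟩ := hs.1.exists_perm_canonicalTable
  obtain ⟨σ', ε', hσ'⟩ := hs'.1.exists_perm_canonicalTable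
  rw [h] at hσ
  have hs0 : tripleParity (fun i j => s (σ i) (σ j)) 0 1 2 ≠
      tripleParity (fun i j => s (σ i) (σ j)) 0 1 3 ∨
      ∃ ε, ∀ i j k, i ≠ j → i ≠ k → j ≠ k →
        tripleParity (fun i j => s (σ i) (σ j)) i j k = ε := by
    refine (tripleParity_canonicalTable (oddMulEven s')).imp (fun h => ?_) fun h => ⟨ε, ?_⟩
    · change tripleParity s (σ 0) (σ 1) (σ 2) ≠ tripleParity s (σ 0) (σ 1) (σ 3)
      rw [hσ 0 1 2 (by decide) (by decide) (by decide),
        hσ 0 1 3 (by decide) (by decide) (by decide)]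
      simpa using h
    · intro i j k hij hik hjk
      exact (hσ i j k hij hik hjk).trans (by rw [h, Bool.xor_false])
  by_cases hε : ε = ε'
  · refine .inl (DeformEquiv.of_comp (σ := σ) (σ' := σ') (deformEquiv_of_lk_eq
      (hL.comp σ.injective) (hL'.comp σ'.injective) (fun i j k hij hik hjk => ?_)
      (hs.comp σ.injective) hs0))
    simp only [Function.comp]
    rw [hs.2 _ _ _ (σ.injective.ne hij) (σ.injective.ne hik) (σ.injective.ne hjk),
      hs'.2 _ _ _ (σ'.injective.ne hij) (σ'.injective.ne hik) (σ'.injective.ne hjk),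
      hσ i j k hij hik hjk, hσ' i j k hij hik hjk, hε]
  · refine .inr ⟨_, isMirror_mirrorLine L', DeformEquiv.of_comp (σ := σ) (σ' := σ')
      (deformEquiv_of_lk_eq (hL.comp σ.injective) (hL'.mirrorLine.comp σ'.injective)
      (fun i j k hij hik hjk => ?_) (hs.comp σ.injective) hs0)⟩
    simp only [Function.comp]
    rw [lk_mirrorLine (hL'.isLine _) (hL'.isLine _) (hL'.isLine _),
      hs.2 _ _ _ (σ.injective.ne hij) (σ.injective.ne hik) (σ.injective.ne hjk),
      hs'.2 _ _ _ (σ'.injective.ne hij) (σ'.injective.ne hik) (σ'.injective.ne hjk),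
      hσ i j k hij hik hjk, hσ' i j k hij hik hjk]
    rw [Bool.eq_not.2 hε]
    generalize tripleParity (canonicalTable (oddMulEven s')) i j k = b
    cases ε' <;> cases b <;> simp

lemma coarseDeformEquiv_iff {L L' : Fin 5 → PLine} (hL : PairwiseSkew L)
    (hL' : PairwiseSkew L') {s s' : Fin 5 → Fin 5 → Bool} (hs : HasLkTable L s)
    (hs' : HasLkTable L' s') : CoarseDeformEquiv L L' ↔ oddMulEven s = oddMulEven s' :=
  ⟨fun h => h.oddMulEven_eq hL' hs hs', coarseDeformEquiv_of_oddMulEven_eq hL hL' hs hs'⟩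

lemma even_card_filter_eq_false_iff (t : Fin 6 → Bool) :
    Even ({k | t k = false} : Finset (Fin 6)).card ↔
      (t 0 ^^ t 1 ^^ t 2 ^^ t 3 ^^ t 4 ^^ t 5) = false := by
  rw [Finset.card_filter, Fin.sum_univ_six]
  generalize t 0 = a, t 1 = b, t 2 = c, t 3 = d, t 4 = e, t 5 = f
  revert a b c d e f
  decide

lemma xor_tripleParity_eq_false_iff (s : Fin 6 → Fin 6 → Bool) (i j : Fin 6) :
    (tripleParity s i j 0 ^^ tripleParity s i j 1 ^^ tripleParity s i j 2 ^^
      tripleParity s i j 3 ^^ tripleParity s i j 4 ^^ tripleParity s i j 5) = false ↔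
      rowParity s i = rowParity s j := by
  have h (c a₀ a₁ a₂ a₃ a₄ a₅ b₀ b₁ b₂ b₃ b₄ b₅ : Bool) :
      ((c ^^ a₀ ^^ b₀) ^^ (c ^^ a₁ ^^ b₁) ^^ (c ^^ a₂ ^^ b₂) ^^ (c ^^ a₃ ^^ b₃) ^^
        (c ^^ a₄ ^^ b₄) ^^ (c ^^ a₅ ^^ b₅)) =
      ((a₀ ^^ a₁ ^^ a₂ ^^ a₃ ^^ a₄ ^^ a₅) ^^ (b₀ ^^ b₁ ^^ b₂ ^^ b₃ ^^ b₄ ^^ b₅)) := by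
    cases c <;> simp only [Bool.false_xor, Bool.true_xor] <;>
      simp [Bool.xor_left_comm, Bool.xor_comm]
  simp only [tripleParity, h, rowParity]
  exact bne_eq_false_iff_eq

lemma HasLkTable.even_ncard_iff {L : Fin 6 → PLine} {s : Fin 6 → Fin 6 → Bool}
    (h : HasLkTable L s) {i j : Fin 6} (hij : i ≠ j) :
    Even {k : Fin 6 | k ≠ i ∧ k ≠ j ∧ lk (L i) (L j) (L k) = 1}.ncard ↔
      rowParity s i = rowParity s j := by
  have hset : {k : Fin 6 | k ≠ i ∧ k ≠ j ∧ lk (L i) (L j) (L k) = 1} =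
      ↑({k : Fin 6 | k ≠ i ∧ k ≠ j ∧ tripleParity s i j k = false} : Finset (Fin 6)) := by
    ext k
    simp only [Set.mem_ofPred_eq, Finset.coe_filter, Finset.mem_univ, true_and]
    refine and_congr_right fun hki => and_congr_right fun hkj => ?_
    rw [h.2 i j k hij hki.symm hkj.symm]
    cases tripleParity s i j k <;> norm_num
  have hself (k : Fin 6) (hk : k = i ∨ k = j) : tripleParity s i j k = false := by
    rcases hk with rfl | rfl
    · simp [tripleParity, h.1.2, h.1.1 j]
    · simp [tripleParity, h.1.2]
  have hins : ({k | tripleParity s i j k = false} : Finset (Fin 6)) =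
      insert i (insert j ({k | k ≠ i ∧ k ≠ j ∧ tripleParity s i j k = false} : Finset _)) := by
    ext k
    simp only [Finset.mem_filter, Finset.mem_univ, true_and, Finset.mem_insert]
    have := hself k
    tauto
  have heven := even_card_filter_eq_false_iff (tripleParity s i j)
  rw [hins, Finset.card_insert_of_notMem (by simp [hij]), Finset.card_insert_of_notMem (by simp),
    Nat.even_add_one, Nat.even_add_one, not_not] at heven
  rw [hset, Set.ncard_coe_finset, heven]
  exact xor_tripleParity_eq_false_iff s i j

theorem homogeneous_iff_viro_cocycle (L : Fin 6 → PLine) (hL : PairwiseSkew L) :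
    (∀ i j : Fin 6, CoarseDeformEquiv (L ∘ i.succAbove) (L ∘ j.succAbove)) ↔
    (∀ i j : Fin 6, i ≠ j →
      Even ({k : Fin 6 | k ≠ i ∧ k ≠ j ∧ lk (L i) (L j) (L k) = 1}.ncard)) := by
  obtain ⟨s, hs, h0⟩ : ∃ s, HasLkTable L s ∧ ∀ i, s 0 i = false := by
    obtain ⟨s, hs⟩ := hL.exists_hasLkTable
    exact ⟨_, hs.switchTable, hs.1.switchTable_zero⟩
  have hsub (i j : Fin 6) := coarseDeformEquiv_iff
    (hL.comp (Fin.succAbove_right_injective (p := i)))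
    (hL.comp (Fin.succAbove_right_injective (p := j)))
    (hs.comp Fin.succAbove_right_injective) (hs.comp Fin.succAbove_right_injective)
  have hrow : rowParity s 0 = false := by simp [rowParity, h0]
  calc (∀ i j : Fin 6, CoarseDeformEquiv (L ∘ i.succAbove) (L ∘ j.succAbove))
    _ ↔ ∀ i, rowParity s i = false := by
      rw [rowParity_eq_false_iff hs.1 h0]
      simp only [hsub]
      exact ⟨fun h i => h i 0, fun h i j => (h i).trans (h j).symm⟩
    _ ↔ ∀ i j, i ≠ j → rowParity s i = rowParity s j := by
      refine ⟨fun h i j _ => (h i).trans (h j).symm, fun h i => ?_⟩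
      by_cases hi : i = 0
      · rw [hi, hrow]
      · rw [h i 0 hi, hrow]
    _ ↔ _ := by
      refine forall_congr' fun i => forall_congr' fun j => forall_congr' fun hij => ?_
      rw [hs.even_ncard_iff hij]
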